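/- arXiv:1505.04993 — 3 statements merged into one kernel-verified Lean document; each statement's English description precedes it below -/
import Mathlib

section
/- Let F be the free group on two generators z and y. An element w of F is called primitive if it belongs to some generating pair of F (equivalently, w is the image of a generator under an automorphism of F). If w is primitive and a cyclically reduced word representing (a conjugate of) w contains the letter y, then it cannot contain the letter y⁻¹; similarly it cannot contain both z and z⁻¹. -/
/-- `F = ⟨z, y⟩` is the free group on two generators, where the generator `true`
is `z` and the generator `false` is `y`.  An element is *primitive* if it is a
member of some generating pair of `F`. -/
def IsPrimitive (w : FreeGroup Bool) : Prop :=
  ∃ w' : FreeGroup Bool, Subgroup.closure {w, w'} = ⊤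

namespace PrimAux
open FreeGroup

/-- Length of the longest common prefix of two lists. -/
def lcpLen {α : Type} [DecidableEq α] : List α → List α → ℕ
  | a :: A, b :: B => if a = b then lcpLen A B + 1 else 0
  | _, _ => 0

theorem lcpLen_le_left {α : Type} [DecidableEq α] :
    ∀ A B : List α, lcpLen A B ≤ A.length
  | [], B => by simp [lcpLen]
  | a :: A, [] => by simp [lcpLen]
  | a :: A, b :: B => by
    have := lcpLen_le_left A B
    simp only [lcpLen, List.length_cons]; split_ifs <;> omega

theorem lcpLen_comm {α : Type} [DecidableEq α] :
    ∀ A B : List α, lcpLen A B = lcpLen B A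
  | [], [] => rfl
  | [], _ :: _ => rfl
  | a :: A, [] => by simp [lcpLen]
  | a :: A, b :: B => by
    simp only [lcpLen, lcpLen_comm A B, eq_comm]

theorem lcpLen_le_right {α : Type} [DecidableEq α] (A B : List α) :
    lcpLen A B ≤ B.length := by
  rw [lcpLen_comm]; exact lcpLen_le_left _ _

theorem lcpLen_take {α : Type} [DecidableEq α] :
    ∀ (A B : List α) (n : ℕ), n ≤ lcpLen A B → A.take n = B.take n
  | [], B, n, h => by
    have : n = 0 := by simpa [lcpLen] using h
    simp [this]
  | a :: A, [], n, h => by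
    have : n = 0 := by simpa [lcpLen] using h
    simp [this]
  | a :: A, b :: B, 0, h => by simp
  | a :: A, b :: B, n + 1, h => by
    simp only [lcpLen] at h
    split_ifs at h with hab
    · simp [hab, lcpLen_take A B n (by omega)]
    · omega

theorem lcpLen_ultra {α : Type} [DecidableEq α] :
    ∀ A B C : List α, min (lcpLen A B) (lcpLen B C) ≤ lcpLen A C
  | [], B, C => by simp [lcpLen]
  | a :: A, [], C => by simp [lcpLen]
  | a :: A, b :: B, [] => by simp [lcpLen]
  | a :: A, b :: B, c :: C => by
    have := lcpLen_ultra A B C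
    simp only [lcpLen]
    split_ifs <;> simp_all

theorem isReduced_invRev {A : List (Bool × Bool)} (h : IsReduced A) : IsReduced (invRev A) := by
  rw [isReduced_iff_reduce_eq] at *
  rw [reduce_invRev, h]

theorem norm_lcp_aux : ∀ A B : List (Bool × Bool), IsReduced A → IsReduced B →
    ((mk A)⁻¹ * mk B).norm + 2 * lcpLen A B = A.length + B.length
  | [], B, _, hB => by
    simp only [← one_eq_mk, inv_one, one_mul, lcpLen, FreeGroup.norm, toWord_mk, hB.reduce_eq]; simp
  | a :: A, [], hA, _ => by
    simp only [← one_eq_mk, mul_one, lcpLen, norm_inv_eq]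
    simp only [FreeGroup.norm, toWord_mk, hA.reduce_eq]; simp
  | a :: A, b :: B, hA, hB => by
    simp only [lcpLen]
    split_ifs with hab
    · subst hab
      have ih := norm_lcp_aux A B (List.IsChain.tail hA) (List.IsChain.tail hB)
      have e : (mk (a :: A))⁻¹ * mk (a :: B) = (mk A)⁻¹ * mk B := by
        have h1 : mk (a :: A) = mk [a] * mk A := by simp [mul_mk]
        have h2 : mk (a :: B) = mk [a] * mk B := by simp [mul_mk]
        rw [h1, h2]; group
      rw [e]; simp only [List.length_cons]; omega
    · have hr : IsReduced (invRev (a :: A) ++ (b :: B)) := by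
        refine List.isChain_append.2 ⟨isReduced_invRev hA, hB, ?_⟩
        intro x hx y hy
        simp [invRev] at hx hy
        subst hx hy
        intro h
        rcases a with ⟨a1, a2⟩
        rcases b with ⟨b1, b2⟩
        simp at *
        cases a2 <;> cases b2 <;> simp_all
      rw [inv_mk, mul_mk, FreeGroup.norm, toWord_mk, hr.reduce_eq]; simp

abbrev F2 := FreeGroup Bool

/-- common prefix length in the group -/
def cpl (x y : F2) : ℕ := lcpLen x.toWord y.toWord

theorem norm_cpl (x y : F2) : (x⁻¹ * y).norm + 2 * cpl x y = x.norm + y.norm := by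
  have := norm_lcp_aux x.toWord y.toWord isReduced_toWord isReduced_toWord
  rwa [mk_toWord, mk_toWord] at this

theorem cpl_ultra (x y z : F2) : min (cpl x y) (cpl y z) ≤ cpl x z := lcpLen_ultra _ _ _
theorem cpl_comm (x y : F2) : cpl x y = cpl y x := lcpLen_comm _ _
theorem cpl_le_left (x y : F2) : cpl x y ≤ x.norm := lcpLen_le_left _ _
theorem cpl_le_right (x y : F2) : cpl x y ≤ y.norm := lcpLen_le_right _ _

/-- Cancellation of `u` with `v` versus the surviving suffix of `v`. -/
theorem cpl_mul (u v : F2) : cpl (u * v)⁻¹ v⁻¹ + cpl u⁻¹ v = v.norm := by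
  have h1 := norm_cpl (u * v)⁻¹ v⁻¹
  have h2 := norm_cpl u⁻¹ v
  have e : ((u * v)⁻¹)⁻¹ * v⁻¹ = u := by group
  rw [e] at h1
  rw [inv_inv] at h2
  simp only [norm_inv_eq] at h1 h2
  omega

theorem mk_take_drop (v : F2) (m : ℕ) (h : v.norm = 2 * m) :
    v = mk (v.toWord.take m) * (mk ((v⁻¹).toWord.take m))⁻¹ := by
  have e : (v⁻¹).toWord = invRev (v.toWord.drop m) ++ invRev (v.toWord.take m) := by
    rw [toWord_inv, ← invRev_append, List.take_append_drop]
  have hl : (invRev (v.toWord.drop m)).length = m := by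
    rw [invRev_length, List.length_drop]
    unfold FreeGroup.norm at h; omega
  rw [e, List.take_left' hl, inv_mk, invRev_invRev, mul_mk, List.take_append_drop, mk_toWord]

theorem cpl_self_inv (v : F2) (hv : v ≠ 1) : 2 * cpl v⁻¹ v < v.norm := by
  by_contra hcon
  push Not at hcon
  rcases Nat.even_or_odd' v.norm with ⟨k, hk | hk⟩
  · have ht := lcpLen_take (v⁻¹).toWord v.toWord k (by unfold cpl at hcon; omega)
    apply hv
    rw [mk_take_drop v k hk, ht, mul_inv_cancel]
  · have ht := lcpLen_take (v⁻¹).toWord v.toWord (k+1) (by unfold cpl at hcon; omega)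
    have ht' := congrArg (fun l => l[k]?) ht
    have hk' : v.toWord.length = 2 * k + 1 := hk
    simp only [List.getElem?_take, toWord_inv, invRev, lt_add_iff_pos_right, zero_lt_one, if_true] at ht'
    rw [List.getElem?_reverse (by simp; omega)] at ht'
    simp only [List.length_map, hk'] at ht'
    rw [show 2 * k + 1 - 1 - k = k by omega, List.getElem?_map,
      List.getElem?_eq_getElem (by omega)] at ht'
    simp at ht'
    have := congrArg Prod.snd ht'
    simp at this

/-- Predicates on pairs closed under Nielsen moves and simultaneous conjugation. -/
structure Moves (B : F2 → F2 → Prop) : Prop where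
  swap : ∀ a b, B a b → B b a
  inv : ∀ a b, B a b → B a⁻¹ b
  mul : ∀ a b, B a b → B a (a * b)
  conj : ∀ g a b, B a b → B (g * a * g⁻¹) (g * b * g⁻¹)

namespace Moves
theorem inv_right {B : F2 → F2 → Prop} (h : Moves B) (a b : F2) (hb : B a b) : B a b⁻¹ := h.swap _ _ (h.inv _ _ (h.swap _ _ hb))
theorem mul_inv {B : F2 → F2 → Prop} (h : Moves B) (a b : F2) (hb : B a b) : B a (a⁻¹ * b) := by
  simpa using h.inv _ _ (h.mul _ _ (h.inv _ _ hb))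
theorem mul_right {B : F2 → F2 → Prop} (h : Moves B) (a b : F2) (hb : B a b) : B a (b * a) := by
  simpa using h.inv_right _ _ (h.mul_inv _ _ (h.inv_right _ _ hb))
theorem compl {B : F2 → F2 → Prop} (h : Moves B) : Moves (fun a b => ¬ B a b) where
  swap a b hn hb := hn (h.swap _ _ hb)
  inv a b hn hb := hn (by simpa using h.inv _ _ hb)
  mul a b hn hb := hn (by simpa using h.mul_inv _ _ hb)
  conj g a b hn hb := hn (by simpa [mul_assoc] using h.conj g⁻¹ _ _ hb)
end Moves

theorem Moves.and {B C : F2 → F2 → Prop} (h : Moves B) (k : Moves C) :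
    Moves (fun a b => B a b ∧ C a b) where
  swap a b hb := ⟨h.swap _ _ hb.1, k.swap _ _ hb.2⟩
  inv a b hb := ⟨h.inv _ _ hb.1, k.inv _ _ hb.2⟩
  mul a b hb := ⟨h.mul _ _ hb.1, k.mul _ _ hb.2⟩
  conj g a b hb := ⟨h.conj g _ _ hb.1, k.conj g _ _ hb.2⟩

/-- generating pairs -/
def Gen (a b : F2) : Prop := Subgroup.closure {a, b} = ⊤

theorem gen_of {a b c d : F2} (h : Gen a b) (ha : a ∈ Subgroup.closure {c, d})
    (hb : b ∈ Subgroup.closure {c, d}) : Gen c d := by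
  unfold Gen at *
  rw [eq_top_iff, ← h, Subgroup.closure_le]
  rintro x (rfl | rfl)
  · exact ha
  · exact hb

theorem gen_moves : Moves Gen where
  swap a b h := by unfold Gen at *; rwa [Set.pair_comm]
  inv a b h := by
    have ha : a⁻¹ ∈ Subgroup.closure {a⁻¹, b} := Subgroup.subset_closure (by simp)
    exact gen_of h (by simpa using inv_mem ha) (Subgroup.subset_closure (by simp))
  mul a b h := by
    have ha : a ∈ Subgroup.closure {a, a * b} := Subgroup.subset_closure (by simp)
    have hb : a * b ∈ Subgroup.closure {a, a * b} := Subgroup.subset_closure (by simp)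
    exact gen_of h ha (by simpa using mul_mem (inv_mem ha) hb)
  conj g a b h := by
    unfold Gen at *
    have := MonoidHom.map_closure (MulAut.conj g).toMonoidHom {a, b}
    rw [h, Set.image_pair] at this
    have e : Subgroup.map (MulAut.conj g).toMonoidHom ⊤ = ⊤ := by
      rw [← MonoidHom.range_eq_map, MonoidHom.range_eq_top]
      exact (MulAut.conj g).surjective
    rw [e] at this
    simpa using this.symm

/-- Pairs obtained by positive moves and conjugations from a standard basis. -/
inductive PosPair : F2 → F2 → Prop
  | base (s t : Bool) : PosPair (mk [(true, s)]) (mk [(false, t)])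
  | swap (a b : F2) : PosPair a b → PosPair b a
  | mul (a b : F2) : PosPair a b → PosPair a (a * b)
  | conj (g a b : F2) : PosPair a b → PosPair (g * a * g⁻¹) (g * b * g⁻¹)

def Good (a b : F2) : Prop :=
  PosPair a b ∨ PosPair a b⁻¹ ∨ PosPair a⁻¹ b ∨ PosPair a⁻¹ b⁻¹

theorem Good.swap {a b : F2} (h : Good a b) : Good b a := by
  rcases h with h | h | h | h
  · exact .inl h.swap
  · exact .inr (.inr (.inl h.swap))
  · exact .inr (.inl h.swap)
  · exact .inr (.inr (.inr h.swap))

theorem Good.inv {a b : F2} (h : Good a b) : Good a⁻¹ b := by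
  unfold Good at *
  simp only [inv_inv]
  tauto

theorem Good.inv_right {a b : F2} (h : Good a b) : Good a b⁻¹ := h.swap.inv.swap

theorem Good.conj (g : F2) {a b : F2} (h : Good a b) : Good (g * a * g⁻¹) (g * b * g⁻¹) := by
  unfold Good at *
  simp only [conj_inv]
  rcases h with h | h | h | h
  · exact .inl (h.conj g)
  · exact .inr (.inl (h.conj g))
  · exact .inr (.inr (.inl (h.conj g)))
  · exact .inr (.inr (.inr (h.conj g)))

theorem PosPair.nielsen {a b : F2} (h : PosPair a b) :
    Good a (a⁻¹ * b) ∧ Good b (b⁻¹ * a) := by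
  induction h with
  | base s t =>
    constructor
    · have h := (PosPair.base (!s) t).mul
      have e : (mk [(true, s)] : F2)⁻¹ = mk [(true, !s)] := by simp [inv_mk, invRev]
      rw [← e] at h
      exact .inr (.inr (.inl h))
    · have h := (PosPair.base s (!t)).swap.mul
      have e : (mk [(false, t)] : F2)⁻¹ = mk [(false, !t)] := by simp [inv_mk, invRev]
      rw [← e] at h
      exact .inr (.inr (.inl h))
  | swap a b h ih => exact ih.symm
  | mul a b h ih =>
    constructor
    · rw [inv_mul_cancel_left]; exact .inl h
    · have h1 := (h.swap.mul.conj b⁻¹).swap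
      have e1 : b⁻¹ * (b * a) * b⁻¹⁻¹ = a * b := by group
      have e2 : b⁻¹ * b * b⁻¹⁻¹ = b := by group
      have e3 : (a * b)⁻¹ * a = b⁻¹ := by group
      rw [e1, e2] at h1
      rw [e3]
      exact .inr (.inl (by simpa using h1))
  | conj g a b h ih =>
    have h1 := ih.1.conj g
    have h2 := ih.2.conj g
    constructor
    · convert h1 using 1; group
    · convert h2 using 1; group

theorem good_moves : Moves Good where
  swap a b h := h.swap
  inv a b h := h.inv
  conj g a b h := h.conj g
  mul a b h := by
    have key : ∀ {c : F2}, Good a (b * a) → Good a (a * b) := by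
      intro c h
      have := h.conj a
      have e1 : a * a * a⁻¹ = a := by group
      have e2 : a * (b * a) * a⁻¹ = a * b := by group
      rwa [e1, e2] at this
    rcases h with h | h | h | h
    · exact .inl h.mul
    · have := h.nielsen.1.inv_right
      exact key (c := 1) (by simpa using this)
    · have := h.nielsen.1.inv
      simpa using this
    · have : Good a⁻¹ (a⁻¹ * b⁻¹) := .inl h.mul
      have := this.inv.inv_right
      exact key (c := 1) (by simpa using this)

/-- A pair of minimal total length satisfying `B`. -/
def MinPair (B : F2 → F2 → Prop) (a b : F2) : Prop :=
  B a b ∧ ∀ a' b', B a' b' → a.norm + b.norm ≤ a'.norm + b'.norm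

theorem MinPair.swap {B : F2 → F2 → Prop} (hB : Moves B) {a b : F2} (h : MinPair B a b) : MinPair B b a :=
  ⟨hB.swap _ _ h.1, fun a' b' h' => by have := h.2 _ _ h'; omega⟩

theorem MinPair.inv {B : F2 → F2 → Prop} (hB : Moves B) {a b : F2} (h : MinPair B a b) : MinPair B a⁻¹ b :=
  ⟨hB.inv _ _ h.1, fun a' b' h' => by have := h.2 _ _ h'; rw [norm_inv_eq]; omega⟩

theorem MinPair.cpl_le_right {B : F2 → F2 → Prop} (hB : Moves B) {a b : F2} (h : MinPair B a b) : 2 * cpl a⁻¹ b ≤ a.norm := by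
  have h1 := h.2 _ _ (hB.mul _ _ h.1)
  have h2 := norm_cpl a⁻¹ b
  rw [inv_inv, norm_inv_eq] at h2
  omega

theorem MinPair.cpl_le_left {B : F2 → F2 → Prop} (hB : Moves B) {a b : F2} (h : MinPair B a b) : 2 * cpl a⁻¹ b ≤ b.norm := by
  have h1 := h.2 _ _ (hB.swap _ _ (hB.mul_right _ _ (hB.swap _ _ h.1)))
  have h2 := norm_cpl a⁻¹ b
  rw [inv_inv, norm_inv_eq] at h2
  omega

theorem MinPair.triple {B : F2 → F2 → Prop} (hB : Moves B) {a b : F2} (h : MinPair B a b) (ha : a ≠ 1) :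
    cpl b⁻¹ a + cpl a⁻¹ b < a.norm := by
  by_contra hcon
  push Not at hcon
  have l1 := h.cpl_le_right hB
  have l2 := (h.swap hB).cpl_le_left hB
  have l3 := h.cpl_le_left hB
  obtain ⟨m, hm⟩ : ∃ m, m = cpl a⁻¹ b := ⟨_, rfl⟩
  have hn : a.norm = 2 * m := by omega
  have hm0 : 0 < m := by
    rcases Nat.eq_zero_or_pos m with h0 | h0
    · exact absurd (norm_eq_zero.1 (by rw [hn, h0])) ha
    · exact h0
  have hQ := lcpLen_take (a⁻¹).toWord b.toWord m (by unfold cpl at *; omega)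
  have hP := lcpLen_take (b⁻¹).toWord a.toWord m (by unfold cpl at *; omega)
  have hsplit := mk_take_drop a m hn
  rw [hQ, ← hP] at hsplit
  have hbl : 2 * m ≤ b.toWord.length := by unfold FreeGroup.norm at l3; omega
  -- decompose b
  have e : (b⁻¹).toWord = invRev (b.toWord.drop m) ++ invRev (b.toWord.take m) := by
    rw [toWord_inv, ← invRev_append, List.take_append_drop]
  obtain ⟨T, hT⟩ : ∃ T, T = invRev (b.toWord.drop m) := ⟨_, rfl⟩
  have hTl : T.length = b.toWord.length - m := by
    rw [hT, invRev_length, List.length_drop]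
  obtain ⟨Q, hQd⟩ : ∃ Q, Q = b.toWord.take m := ⟨_, rfl⟩
  have hPt : (b⁻¹).toWord.take m = T.take m := by
    rw [e, ← hT, List.take_append_of_le_length (by omega)]
  rw [hPt, ← hQd] at hsplit
  have hbT : b = mk Q * (mk T)⁻¹ := by
    rw [hT, hQd, inv_mk, invRev_invRev, mul_mk, List.take_append_drop, mk_toWord]
  have hT2 : (mk T : F2) = mk (T.take m) * mk (T.drop m) := by
    rw [mul_mk, List.take_append_drop]
  have hnew := hB.conj (mk Q)⁻¹ _ _ (hB.mul_right _ _ h.1)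
  have e1 : (mk Q)⁻¹ * a * (mk Q)⁻¹⁻¹ = (mk Q)⁻¹ * mk (T.take m) := by
    rw [hsplit]; group
  have e2 : (mk Q)⁻¹ * (b * a) * (mk Q)⁻¹⁻¹ = (mk (T.drop m))⁻¹ := by
    rw [hsplit, hbT, hT2]; group
  rw [e1, e2] at hnew
  have hlen := h.2 _ _ hnew
  have n1 := norm_mul_le (mk Q)⁻¹ (mk (T.take m))
  have n2 : (mk Q : F2).norm ≤ m := norm_mk_le.trans (by rw [hQd]; simp)
  have n3 : (mk (T.take m) : F2).norm ≤ m := norm_mk_le.trans (by simp)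
  have n4 : (mk (T.drop m) : F2).norm ≤ b.toWord.length - 2 * m :=
    norm_mk_le.trans (by rw [List.length_drop]; omega)
  rw [norm_inv_eq] at hlen n1
  unfold FreeGroup.norm at *
  omega

/-- Two letters may be adjacent in a reduced word. -/
def Compat (l k : Bool × Bool) : Prop := l.1 = k.1 → l.2 = k.2

theorem growth (φ : F2 →* F2) (h0 : ∀ l, φ (mk [l]) ≠ 1)
    (h1 : ∀ l k, Compat l k → 2 * cpl (φ (mk [l]))⁻¹ (φ (mk [k])) ≤ (φ (mk [l])).norm)
    (h2 : ∀ k l m, Compat k l → Compat l m →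
      cpl (φ (mk [k]))⁻¹ (φ (mk [l])) + cpl (φ (mk [l]))⁻¹ (φ (mk [m])) < (φ (mk [l])).norm)
    (W : List (Bool × Bool)) : ∀ l m, IsReduced (W ++ [l]) → Compat l m →
      cpl (φ (mk (W ++ [l])))⁻¹ (φ (mk [m])) = cpl (φ (mk [l]))⁻¹ (φ (mk [m])) ∧
      cpl (φ (mk [l]))⁻¹ (φ (mk [m])) + W.length + 1 ≤ (φ (mk (W ++ [l]))).norm := by
  induction W using List.reverseRecOn with
  | nil =>
    intro l m _ hlm
    have a := h1 l m hlm
    have b : (φ (mk [l])).norm ≠ 0 := fun h => h0 l (norm_eq_zero.1 h)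
    refine ⟨rfl, ?_⟩
    simp only [List.nil_append, List.length_nil]
    omega
  | append_singleton W k ih =>
    intro l m hred hlm
    have hc := List.isChain_append.1 hred
    have hkl : Compat k l := hc.2.2 k (by simp) l (by simp)
    obtain ⟨i1, i2⟩ := ih k l hc.1 hkl
    have ht := h2 k l m hkl hlm
    have e : φ (mk (W ++ [k] ++ [l])) = φ (mk (W ++ [k])) * φ (mk [l]) := by
      rw [← _root_.map_mul, mul_mk]
    rw [e]
    have c1 := cpl_mul (φ (mk (W ++ [k]))) (φ (mk [l]))
    have c2 := norm_cpl (φ (mk (W ++ [k])))⁻¹ (φ (mk [l]))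
    rw [inv_inv, norm_inv_eq] at c2
    generalize φ (mk (W ++ [k])) = P at *
    generalize φ (mk [l]) = x at *
    generalize φ (mk [m]) = y at *
    have u1 := cpl_ultra (P * x)⁻¹ x⁻¹ y
    have u2 := cpl_ultra x⁻¹ (P * x)⁻¹ y
    rw [cpl_comm x⁻¹ (P * x)⁻¹] at u2
    constructor
    · omega
    · simp only [List.length_append, List.length_singleton]
      omega

theorem Gen.ne_one {a b : F2} (h : Gen a b) : a ≠ 1 := by
  rintro rfl
  unfold Gen at h
  rw [Subgroup.closure_insert_one, ← Subgroup.zpowers_eq_closure] at h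
  have h1 : (of true : F2) ∈ Subgroup.zpowers b := by rw [h]; trivial
  have h2 : (of false : F2) ∈ Subgroup.zpowers b := by rw [h]; trivial
  obtain ⟨n, hn⟩ := h1
  obtain ⟨m, hm⟩ := h2
  have : (of true * of false : F2) = of false * of true := by
    rw [← hn, ← hm]
    exact ((Commute.refl b).zpow_zpow n m).eq
  revert this
  decide

theorem nielsen_std {B : F2 → F2 → Prop} (hB : Moves B) (hg : ∀ a b, B a b → Gen a b)
    {a b : F2} (hab : B a b) : B (of true) (of false) := by
  classical
  -- choose a minimal pair
  obtain ⟨⟨a, b⟩, hmin⟩ : ∃ p : F2 × F2, MinPair B p.1 p.2 := by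
    have hex : ∃ n, ∃ p : F2 × F2, B p.1 p.2 ∧ p.1.norm + p.2.norm = n :=
      ⟨_, (a, b), hab, rfl⟩
    obtain ⟨p, hp, hn⟩ := Nat.find_spec hex
    refine ⟨p, hp, fun a' b' h' => ?_⟩
    rw [hn]
    exact Nat.find_min' hex ⟨(a', b'), h', rfl⟩
  simp only at hmin
  obtain ⟨φ, hφ⟩ : ∃ φ : F2 →* F2, φ = lift (fun t : Bool => cond t a b) := ⟨_, rfl⟩
  have ha : φ (mk [(true, true)]) = a := by simp [hφ]
  have ha' : φ (mk [(true, false)]) = a⁻¹ := by simp [hφ]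
  have hb : φ (mk [(false, true)]) = b := by simp [hφ]
  have hb' : φ (mk [(false, false)]) = b⁻¹ := by simp [hφ]
  have hinv : ∀ g s, φ (mk [(g, !s)]) = (φ (mk [(g, s)]))⁻¹ := by
    intro g s
    rw [← _root_.map_inv, inv_mk]; simp [invRev]
  have hM : ∀ l k : Bool × Bool, l.1 ≠ k.1 → MinPair B (φ (mk [l])) (φ (mk [k])) := by
    have base := hmin
    have i1 := base.inv hB
    have i2 := ((base.swap hB).inv hB).swap hB
    have i3 := i2.inv hB
    rintro ⟨_ | _, _ | _⟩ ⟨_ | _, _ | _⟩ h <;> simp only [ha, ha', hb, hb'] <;>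
      first
      | exact absurd rfl h
      | assumption
      | exact MinPair.swap hB (by assumption)
  have h0 : ∀ l, φ (mk [l]) ≠ 1 := fun l =>
    (hg _ _ (hM l (!l.1, true) (by simp)).1).ne_one
  have hsame : ∀ l k : Bool × Bool, Compat l k → l.1 = k.1 → l = k :=
    fun l k hc h => Prod.ext h (hc h)
  have h1 : ∀ l k, Compat l k → 2 * cpl (φ (mk [l]))⁻¹ (φ (mk [k])) ≤ (φ (mk [l])).norm := by
    intro l k hc
    by_cases h : l.1 = k.1
    · rw [← hsame l k hc h]; exact (cpl_self_inv _ (h0 l)).le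
    · exact (hM l k h).cpl_le_right hB
  have h1' : ∀ l k, Compat l k → 2 * cpl (φ (mk [l]))⁻¹ (φ (mk [k])) ≤ (φ (mk [k])).norm := by
    intro l k hc
    by_cases h : l.1 = k.1
    · rw [← hsame l k hc h]; exact (cpl_self_inv _ (h0 l)).le
    · exact (hM l k h).cpl_le_left hB
  have h2 : ∀ k l m, Compat k l → Compat l m →
      cpl (φ (mk [k]))⁻¹ (φ (mk [l])) + cpl (φ (mk [l]))⁻¹ (φ (mk [m])) < (φ (mk [l])).norm := by
    intro k l m hkl hlm
    have b1 := h1' k l hkl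
    have b2 := h1 l m hlm
    by_cases e1 : k.1 = l.1
    · rw [hsame k l hkl e1] at *
      have := cpl_self_inv _ (h0 l)
      omega
    by_cases e2 : l.1 = m.1
    · rw [← hsame l m hlm e2] at *
      have := cpl_self_inv _ (h0 l)
      omega
    have e3 : k.1 = m.1 := by
      revert e1 e2
      cases k.1 <;> cases l.1 <;> cases m.1 <;> simp
    by_cases e4 : k.2 = m.2
    · rw [← (Prod.ext e3 e4 : k = m)]
      exact (hM l k (Ne.symm e1)).triple hB (h0 l)
    · have hkm : φ (mk [m]) = (φ (mk [k]))⁻¹ := by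
        rw [← hinv k.1 k.2]
        have : m = (k.1, !k.2) := Prod.ext e3.symm (by
          revert e4; cases k.2 <;> cases m.2 <;> simp)
        rw [← this]
      by_contra hcon
      push Not at hcon
      rw [hkm] at hcon b2
      have hl0 := h0 l
      generalize φ (mk [l]) = x at *
      generalize φ (mk [k]) = y at *
      obtain ⟨m', hm'⟩ : ∃ m', m' = cpl y⁻¹ x := ⟨_, rfl⟩
      have hn : x.norm = 2 * m' := by omega
      have t1 := lcpLen_take (y⁻¹).toWord x.toWord m' (by unfold cpl at *; omega)
      have t2 := lcpLen_take (x⁻¹).toWord (y⁻¹).toWord m' (by unfold cpl at *; omega)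
      apply hl0
      rw [mk_take_drop x m' hn, t2, t1, mul_inv_cancel]
  have hsurj : Function.Surjective φ := by
    rw [hφ, lift_surjective_iff_closure_range_eq_top]
    have := hg _ _ hmin.1
    unfold Gen at this
    rw [← this]
    congr 1
    ext x
    simp [eq_comm, or_comm]
  have hlet : ∀ t : Bool, ∃ l, φ (mk [l]) = of t := by
    intro t
    obtain ⟨w, hw⟩ := hsurj (of t)
    rcases List.eq_nil_or_concat w.toWord with hnil | ⟨W, l, hWl⟩
    · rw [toWord_eq_nil_iff] at hnil
      rw [hnil, _root_.map_one] at hw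
      exact absurd hw (one_ne_of t)
    · rw [List.concat_eq_append] at hWl
      have hred : IsReduced (W ++ [l]) := by rw [← hWl]; exact isReduced_toWord
      have hw' : w = mk (W ++ [l]) := by rw [← hWl, mk_toWord]
      have := (growth φ h0 h1 h2 W l l hred (fun _ => rfl)).2
      rw [← hw', hw, norm_of] at this
      have hW : W = [] := List.length_eq_zero_iff.1 (by omega)
      rw [hw', hW] at hw
      exact ⟨l, hw⟩
  obtain ⟨l, hl⟩ := hlet true
  obtain ⟨k, hk⟩ := hlet false
  have hne : l.1 ≠ k.1 := by
    intro h
    by_cases h' : l.2 = k.2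
    · rw [(Prod.ext h h' : l = k), hk] at hl
      revert hl; decide
    · have : l = (k.1, !k.2) := Prod.ext h (by
          revert h'; cases k.2 <;> cases l.2 <;> simp)
      rw [this, hinv k.1 k.2] at hl
      change (φ (mk [k]))⁻¹ = _ at hl
      rw [hk] at hl
      revert hl; decide
  have := (hM l k hne).1
  rwa [hl, hk] at this

theorem good_of_gen {a b : F2} (h : Gen a b) : Good a b := by
  by_contra hn
  have := nielsen_std (gen_moves.and good_moves.compl) (fun _ _ h => h.1) ⟨h, hn⟩
  exact this.2 (.inl (PosPair.base true true))

/-- letters from `z^s, y^t` -/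
def OkLetter (s t : Bool) (l : Bool × Bool) : Prop := l.2 = cond l.1 s t

theorem PosPair.positive {a b : F2} (h : PosPair a b) : ∃ (g : F2) (s t : Bool)
    (A C : List (Bool × Bool)), (∀ l ∈ A, OkLetter s t l) ∧ (∀ l ∈ C, OkLetter s t l) ∧
      a = g * mk A * g⁻¹ ∧ b = g * mk C * g⁻¹ := by
  induction h with
  | base s t =>
    exact ⟨1, s, t, [(true, s)], [(false, t)], by simp [OkLetter], by simp [OkLetter],
      by simp, by simp⟩
  | swap a b h ih =>
    obtain ⟨g, s, t, A, C, hA, hC, ha, hb⟩ := ih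
    exact ⟨g, s, t, C, A, hC, hA, hb, ha⟩
  | mul a b h ih =>
    obtain ⟨g, s, t, A, C, hA, hC, ha, hb⟩ := ih
    refine ⟨g, s, t, A, A ++ C, hA, ?_, ha, ?_⟩
    · intro l hl
      rcases List.mem_append.1 hl with h | h
      · exact hA l h
      · exact hC l h
    · rw [ha, hb, ← mul_mk]; group
  | conj k a b h ih =>
    obtain ⟨g, s, t, A, C, hA, hC, ha, hb⟩ := ih
    exact ⟨k * g, s, t, A, C, hA, hC, by rw [ha]; group, by rw [hb]; group⟩

theorem primitive_positive {a b : F2} (h : Gen a b) : ∃ (g : F2) (s t : Bool)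
    (A : List (Bool × Bool)), (∀ l ∈ A, OkLetter s t l) ∧ a = g * mk A * g⁻¹ := by
  have main : ∀ c d : F2, PosPair c d → a = c ∨ a⁻¹ = c → ∃ (g : F2) (s t : Bool)
      (A : List (Bool × Bool)), (∀ l ∈ A, OkLetter s t l) ∧ a = g * mk A * g⁻¹ := by
    intro c d hp hac
    obtain ⟨g, s, t, A, C, hA, hC, ha, hb⟩ := hp.positive
    rcases hac with h | h
    · exact ⟨g, s, t, A, hA, by rw [h, ha]⟩
    · refine ⟨g, !s, !t, invRev A, ?_, ?_⟩
      · rintro ⟨x, y⟩ hl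
        simp only [invRev, List.mem_reverse, List.mem_map] at hl
        obtain ⟨⟨x', y'⟩, hl, he⟩ := hl
        have := hA _ hl
        simp only [Prod.mk.injEq] at he
        obtain ⟨rfl, rfl⟩ := he
        simp only [OkLetter] at *
        rw [this]; cases x' <;> rfl
      · rw [← inv_mk, ← inv_inj, h, ha]; group
  rcases good_of_gen h with h | h | h | h
  · exact main _ _ h (.inl rfl)
  · exact main _ _ h (.inl rfl)
  · exact main _ _ h (.inr rfl)
  · exact main _ _ h (.inr rfl)

theorem mk_flatten_replicate (L : List (Bool × Bool)) (n : ℕ) :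
    (mk (List.replicate n L).flatten : F2) = mk L ^ n := by
  rw [pow_mk]

/-- A cyclically reduced conjugate of a word in `z^s, y^t` uses only these letters. -/
theorem ok_of_conj {L A : List (Bool × Bool)} {s t : Bool} (hL : IsCyclicallyReduced L)
    (hA : ∀ l ∈ A, OkLetter s t l) (g : F2) (h : mk L = g * mk A * g⁻¹) :
    ∀ l ∈ L, OkLetter s t l := by
  classical
  by_contra hcon
  push Not at hcon
  obtain ⟨l, hl, hbad⟩ := hcon
  obtain ⟨p, hp⟩ : ∃ p : Bool × Bool → Bool, p = fun l => decide (¬ OkLetter s t l) := ⟨_, rfl⟩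
  have hpos : 1 ≤ L.countP p := List.countP_pos_iff.2 ⟨l, hl, by simp [hp, hbad]⟩
  obtain ⟨n, hn⟩ : ∃ n, n = 2 * g.norm + 1 := ⟨_, rfl⟩
  have hA0 : A.countP p = 0 := List.countP_eq_zero.2 (fun x hx => by simp [hp, hA x hx])
  have hrep : ∀ M : List (Bool × Bool), (List.replicate n M).flatten.countP p = n * M.countP p := by
    intro M; simp [List.countP_flatten]
  have e : mk (List.replicate n L).flatten
      = mk (g.toWord ++ (List.replicate n A).flatten ++ invRev g.toWord) := by
    rw [← mul_mk, ← mul_mk, ← inv_mk, mk_toWord, mk_flatten_replicate, mk_flatten_replicate, h,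
      conj_pow]
  have hr := (hL.flatten_replicate n).isReduced.reduce_eq
  have hs : List.Sublist (List.replicate n L).flatten
      (g.toWord ++ (List.replicate n A).flatten ++ invRev g.toWord) := by
    rw [← hr, reduce.sound e]
    exact reduce.red.sublist
  have hc := hs.countP_le (p := p)
  rw [List.countP_append, List.countP_append, hrep, hrep, hA0] at hc
  have c1 : g.toWord.countP p ≤ g.norm := List.countP_le_length
  have c2 : (invRev g.toWord).countP p ≤ g.norm :=
    List.countP_le_length.trans (by rw [invRev_length]; rfl)
  have c3 : n * 1 ≤ n * L.countP p := Nat.mul_le_mul_left n hpos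
  omega
end PrimAux

/-- If `w` is primitive and `L` is a cyclically reduced word representing a conjugate
of `w`, then `L` cannot contain both the letter `y` and the letter `y⁻¹`, and it
cannot contain both the letter `z` and the letter `z⁻¹`.
Letters are pairs `(g, s)` where `g : Bool` is the generator (`true` = `z`,
`false` = `y`) and `s : Bool` is the exponent sign (`true` = `+1`). -/
theorem primitive_cyclically_reduced_no_inverse_pair
    (w : FreeGroup Bool) (hw : IsPrimitive w)
    (L : List (Bool × Bool))
    (hred : (FreeGroup.mk L).toWord = L)
    (hcyc : ∀ a b, L.head? = some (a, b) → L.getLast? ≠ some (a, !b))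
    (u : FreeGroup Bool) (hconj : u * w * u⁻¹ = FreeGroup.mk L) :
    ¬ ((false, true) ∈ L ∧ (false, false) ∈ L) ∧
    ¬ ((true, true) ∈ L ∧ (true, false) ∈ L) := by
  obtain ⟨w', hw'⟩ := hw
  obtain ⟨g, s, t, A, hA, hwA⟩ := PrimAux.primitive_positive (show PrimAux.Gen w w' from hw')
  have hL : FreeGroup.IsCyclicallyReduced L := by
    refine ⟨FreeGroup.IsReduced.of_reduce_eq (by rw [← FreeGroup.toWord_mk]; exact hred), ?_⟩
    rintro ⟨a1, a2⟩ ha ⟨b1, b2⟩ hb hab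
    have h1 := hcyc b1 b2 hb
    simp only at hab
    subst hab
    simp only [Option.mem_def] at ha
    rw [ha] at h1
    revert h1
    cases a2 <;> cases b2 <;> simp
  have hok := PrimAux.ok_of_conj hL hA (u * g) (by rw [← hconj, hwA]; group)
  constructor
  · rintro ⟨h1, h2⟩
    have e1 := hok _ h1
    have e2 := hok _ h2
    simp only [PrimAux.OkLetter, cond_false] at e1 e2
    rw [← e1] at e2
    cases e2
  · rintro ⟨h1, h2⟩
    have e1 := hok _ h1
    have e2 := hok _ h2
    simp only [PrimAux.OkLetter, cond_true] at e1 e2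
    rw [← e1] at e2
    cases e2
end

section
/- Let p > q ≥ 1 be coprime integers, let w_0, …, w_p be the (p,q)-sequence of words in the free group F = ⟨z,y⟩, and let q' be the unique integer with 1 ≤ q' ≤ p/2 and qq' ≡ ±1 (mod p). Then w_j is a primitive element of F if and only if j ∈ {1, q', p−q', p−1}. -/
/-- The word in `F = ⟨z, y⟩` spelled by a list of letters (`true` ↦ `z`, `false` ↦ `y`). -/
def wordOf (L : List Bool) : FreeGroup Bool :=
  (L.map fun b => FreeGroup.of b).prod

/-- Letters of the word `w_j` of the `(p,q)`-sequence. -/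
def pqLetters (p q j : ℕ) : List Bool :=
  (List.range p).map fun i =>
    decide (∃ n ∈ Finset.range j, (i + 1) % p = (1 + n * q) % p)

section suff
variable {G : Type*} [Group G]

inductive Run (a b : ℕ) (Y Z : G) (x0 : ℕ) : ℕ → ℕ → ℕ → G → Prop
  | nil : Run a b Y Z x0 x0 0 0 1
  | ystep (x m n : ℕ) (W : G) : Run a b Y Z x0 x m n W → x < a → Run a b Y Z x0 (x + b) (m+1) n (W * Y)
  | zstep (x m n : ℕ) (W : G) : Run a b Y Z x0 x m n W → a ≤ x → x < a + b →
      Run a b Y Z x0 (x - a) m (n+1) (W * Z)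

lemma Run.ind1 {a b : ℕ} {Y Z : G} {x0 x m n : ℕ} {W : G}
    (h : Run a b Y (Y * Z) x0 x m n W) : Run (a + b) b Y Z x0 x (m + n) n W := by
  induction h with
  | nil => exact Run.nil
  | ystep x m n W _ hx ih =>
    have := Run.ystep x _ _ _ ih (by omega)
    rwa [show m + n + 1 = m + 1 + n by omega] at this
  | zstep x m n W _ h1 h2 ih =>
    have h := Run.ystep x _ _ _ ih (by omega)
    have := Run.zstep _ _ _ _ h (by omega) (by omega)
    rwa [mul_assoc, show x + b - (a + b) = x - a by omega, show m + n + 1 = m + (n + 1) by omega] at this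

lemma Run.ind2 {a b : ℕ} {Y Z : G} {x0 x m n : ℕ} {W : G}
    (h : Run a b (Z * Y) Z x0 x m n W) : Run a (a + b) Y Z (x0 + a) (x + a) m (m + n) W := by
  induction h with
  | nil => exact Run.nil
  | ystep x m n W _ hx ih =>
    have h := Run.zstep _ _ _ _ ih (by omega) (by omega)
    have := Run.ystep _ _ _ _ h (by omega)
    rwa [mul_assoc, show x + a - a + (a + b) = x + b + a by omega,
      show m + n + 1 = m + 1 + n by omega] at this
  | zstep x m n W _ h1 h2 ih =>
    have h := Run.zstep _ _ _ _ ih (by omega) (by omega)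
    rwa [show x + a - a = x - a + a by omega,
      show m + n + 1 = m + (n + 1) by omega] at h

lemma closure_mul_right (Y Z : G) : Subgroup.closure {Y, Y * Z} = Subgroup.closure {Y, Z} := by
  apply le_antisymm
  · rw [Subgroup.closure_le]
    have hY : Y ∈ Subgroup.closure {Y, Z} := Subgroup.subset_closure (by simp)
    have hZ : Z ∈ Subgroup.closure {Y, Z} := Subgroup.subset_closure (by simp)
    rintro g (rfl | rfl)
    · exact hY
    · exact mul_mem hY hZ
  · rw [Subgroup.closure_le]
    have hY : Y ∈ Subgroup.closure {Y, Y * Z} := Subgroup.subset_closure (by simp)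
    have hZ : Y * Z ∈ Subgroup.closure {Y, Y * Z} := Subgroup.subset_closure (by simp)
    rintro g (rfl | rfl)
    · exact hY
    · simpa using mul_mem (inv_mem hY) hZ

lemma closure_mul_left (Y Z : G) : Subgroup.closure {Z * Y, Z} = Subgroup.closure {Y, Z} := by
  rw [Set.pair_comm, closure_mul_right, Set.pair_comm]

lemma exists_run (N : ℕ) : ∀ (a b : ℕ), a + b ≤ N → 1 ≤ a → 1 ≤ b → Nat.Coprime a b → ∀ (Y Z : G),
    ∃ x0 < a + b, ∃ W w' : G, Run a b Y Z x0 x0 a b W ∧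
      Subgroup.closure {W, w'} = Subgroup.closure {Y, Z} := by
  induction N with
  | zero => intro a b h1 h2; omega
  | succ N ih =>
    intro a b hN ha hb hab Y Z
    rcases lt_trichotomy a b with h | h | h
    · obtain ⟨c, rfl⟩ := Nat.exists_eq_add_of_le h.le
      obtain ⟨x0, hx0, W, w', hr, hc⟩ := ih a c (by omega) ha (by omega) (by simpa using hab) (Z * Y) Z
      exact ⟨x0 + a, by omega, W, w', hr.ind2, hc.trans (closure_mul_left _ _)⟩
    · subst h
      have : a = 1 := by simpa using hab
      subst this
      refine ⟨0, by omega, Y * Z, Y, ?_, ?_⟩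
      · have h1 := Run.ystep (a := 1) (b := 1) (Y := Y) (Z := Z) (x0 := 0) _ _ _ _ Run.nil (by omega)
        have h2 := Run.zstep _ _ _ _ h1 (by omega) (by omega)
        simpa using h2
      · rw [Set.pair_comm, closure_mul_right]
    · obtain ⟨c, rfl⟩ := Nat.exists_eq_add_of_le' h.le
      obtain ⟨x0, hx0, W, w', hr, hc⟩ := ih c b (by omega) (by omega) (by omega) (by simpa using hab) Y (Y * Z)
      exact ⟨x0, by omega, W, w', hr.ind1, hc.trans (closure_mul_right _ _)⟩

lemma Run.eq {a b : ℕ} {Y Z : G} {x0 x m n : ℕ} {W : G} (h0 : x0 < a + b)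
    (h : Run a b Y Z x0 x m n W) : x = (x0 + (m + n) * b) % (a + b) ∧
      W = ((List.range (m + n)).map fun i => if (x0 + i * b) % (a + b) < a then Y else Z).prod := by
  induction h with
  | nil => simp [Nat.mod_eq_of_lt h0]
  | ystep x m n W _ hx ih =>
    obtain ⟨h1, h2⟩ := ih
    constructor
    · rw [show x0 + (m + 1 + n) * b = x0 + (m + n) * b + b by ring, Nat.add_mod, ← h1,
        Nat.add_mod_mod]
      rw [Nat.mod_eq_of_lt]; omega
    · rw [show m + 1 + n = m + n + 1 by omega, List.range_succ, List.map_append, List.prod_append, ← h2]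
      simp [← h1, hx]
  | zstep x m n W _ hx hx' ih =>
    obtain ⟨h1, h2⟩ := ih
    constructor
    · rw [show x0 + (m + (n + 1)) * b = x0 + (m + n) * b + b by ring, Nat.add_mod, ← h1,
        Nat.add_mod_mod]
      rw [show x + b = x - a + (a + b) by omega, Nat.add_mod_right, Nat.mod_eq_of_lt]; omega
    · rw [show m + (n + 1) = m + n + 1 by omega, List.range_succ, List.map_append, List.prod_append, ← h2]
      simp [← h1, hx]

lemma prod_shift (h : ℕ → G) (p k : ℕ) (hp : ∀ i, h (i + p) = h i) :
    ((List.range k).map h).prod * ((List.range p).map fun i => h (i + k)).prod =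
    ((List.range p).map h).prod * ((List.range k).map h).prod := by
  have e1 : ((List.range (k + p)).map h).prod =
      ((List.range k).map h).prod * ((List.range p).map fun i => h (i + k)).prod := by
    rw [List.range_add, List.map_append, List.prod_append, List.map_map]
    simp [Function.comp_def, add_comm]
  have e2 : ((List.range (p + k)).map h).prod =
      ((List.range p).map h).prod * ((List.range k).map h).prod := by
    rw [List.range_add, List.map_append, List.prod_append, List.map_map]
    simp [Function.comp_def, add_comm p, hp]
  rw [← e1, ← e2, add_comm]

end suff

lemma IsPrimitive.conj {w v g : FreeGroup Bool} (hw : IsPrimitive w) (h : g * v = w * g) :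
    IsPrimitive v := by
  obtain ⟨w', hw'⟩ := hw
  refine ⟨g⁻¹ * w' * g, ?_⟩
  have hv : v = g⁻¹ * w * g := by rw [mul_assoc, ← h]; group
  have := congrArg (Subgroup.map (MulAut.conj g⁻¹).toMonoidHom) hw'
  rw [MonoidHom.map_closure] at this
  rw [← MonoidHom.range_eq_map, MonoidHom.range_eq_top.2 (MulAut.conj g⁻¹).surjective] at this
  rw [← this, hv]
  congr 1
  simp [Set.image_pair]

lemma primitive_rot (a b x1 : ℕ) (ha : 1 ≤ a) (hb : 1 ≤ b) (hab : Nat.Coprime a b) (hx1 : x1 < a + b)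
    (c : Bool) : IsPrimitive (wordOf ((List.range (a + b)).map fun i =>
      if (x1 + i * b) % (a + b) < a then c else !c)) := by
  obtain ⟨x0, hx0, W, w', hr, hc⟩ := exists_run (a + b) a b le_rfl ha hb hab
    (FreeGroup.of c) (FreeGroup.of (!c))
  have hW := (hr.eq hx0).2
  have hprim : IsPrimitive W := by
    refine ⟨w', hc.trans ?_⟩
    rw [← FreeGroup.closure_range_of]
    congr 1
    ext g
    cases c <;> simp [or_comm]
  have hcop : Nat.Coprime b (a + b) := by simpa using hab.symm
  obtain ⟨k, hk⟩ : ∃ k : ℕ, (x0 + k * b) % (a + b) = x1 := by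
    have : NeZero (a + b) := ⟨by omega⟩
    obtain ⟨u, hu⟩ := (ZMod.isUnit_iff_coprime b (a + b)).2 hcop
    refine ⟨((x1 - x0 : ZMod (a + b)) * ↑u⁻¹).val, ?_⟩
    have : ((x0 + ((x1 - x0 : ZMod (a + b)) * ↑u⁻¹).val * b : ℕ) : ZMod (a + b)) = (x1 : ℕ) := by
      rw [Nat.cast_add, Nat.cast_mul, ZMod.natCast_val, ZMod.cast_id, ← hu, mul_assoc, Units.inv_mul]
      ring
    rw [ZMod.natCast_eq_natCast_iff'] at this
    rw [this, Nat.mod_eq_of_lt hx1]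
  have key := prod_shift (fun i => if (x0 + i * b) % (a + b) < a then FreeGroup.of c else FreeGroup.of (!c))
    (a + b) k (by
      intro i
      rw [show x0 + (i + (a + b)) * b = x0 + i * b + (a + b) * b by ring, Nat.add_mul_mod_self_left])
  rw [← hW] at key
  convert hprim.conj key using 1
  unfold wordOf
  rw [List.map_map]
  congr 1
  apply List.map_congr_left
  intro i _
  have : (x1 + i * b) % (a + b) = (x0 + (i + k) * b) % (a + b) := by
    rw [← hk, Nat.mod_add_mod]; congr 1; ring
  simp only [Function.comp, this]
  split_ifs <;> rfl

lemma letter_iff (p q j i : ℕ) : (∃ n ∈ Finset.range j, (i + 1) % p = (1 + n * q) % p) ↔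
    ∃ n < j, (i : ZMod p) = n * q := by
  simp only [Finset.mem_range]
  refine exists_congr fun n => and_congr_right fun _ => ?_
  rw [← ZMod.natCast_eq_natCast_iff']
  push_cast
  rw [add_comm, add_right_inj]

lemma suff_main (p q j : ℕ) (hj1 : 1 ≤ j) (hjp : j < p)
    (h : (q * j : ZMod p) = 1 ∨ (q * j : ZMod p) = -1) :
    IsPrimitive (wordOf (pqLetters p q j)) := by
  have hu : Nat.Coprime j p := by
    rw [← ZMod.isUnit_iff_coprime]
    rcases h with h | h
    · exact IsUnit.of_mul_eq_one_right _ h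
    · exact IsUnit.of_mul_eq_one_right (-q : ZMod p) (by linear_combination -h)
  have modlt : ∀ m : ℕ, (∃ n < j, (m : ZMod p) = n) ↔ m % p < j := by
    intro m
    constructor
    · rintro ⟨n, hn, e⟩
      rw [ZMod.natCast_eq_natCast_iff', Nat.mod_eq_of_lt (hn.trans hjp)] at e
      omega
    · intro hm
      exact ⟨m % p, hm, by simp⟩
  obtain ⟨b, rfl⟩ := Nat.exists_eq_add_of_le hjp.le
  have hjb : ((b : ℕ) : ZMod (j + b)) = - j := by
    have : ((j + b : ℕ) : ZMod (j + b)) = 0 := ZMod.natCast_self _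
    push_cast at this
    linear_combination this
  have hcop : Nat.Coprime j b := by simpa using hu
  rcases h with h | h
  · convert primitive_rot j b (j - 1) hj1 (by omega) hcop (by omega) true using 2
    unfold pqLetters
    apply List.map_congr_left
    intro i _
    simp only [letter_iff]
    rw [Bool.eq_iff_iff]
    have : (∃ n < j, (i : ZMod (j + b)) = n * q) ↔ (j - 1 + i * b) % (j + b) < j := by
      rw [← modlt]
      push_cast [Nat.cast_sub hj1, hjb]
      constructor
      · rintro ⟨n, hn, e⟩
        refine ⟨j - 1 - n, by omega, ?_⟩
        rw [Nat.cast_sub (by omega), Nat.cast_sub hj1]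
        push_cast
        linear_combination -j * e - n * h
      · rintro ⟨n, hn, e⟩
        refine ⟨j - 1 - n, by omega, ?_⟩
        rw [Nat.cast_sub (by omega), Nat.cast_sub hj1]
        push_cast
        linear_combination -q * e - i * h
    simp only [decide_eq_true_eq, this]
    split_ifs <;> simp [*]
  · convert primitive_rot j b 0 hj1 (by omega) hcop (by omega) true using 2
    unfold pqLetters
    apply List.map_congr_left
    intro i _
    simp only [letter_iff]
    rw [Bool.eq_iff_iff]
    have : (∃ n < j, (i : ZMod (j + b)) = n * q) ↔ (0 + i * b) % (j + b) < j := by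
      rw [← modlt]
      push_cast [hjb]
      refine exists_congr fun n => and_congr_right fun _ => ?_
      constructor
      · intro e
        linear_combination -j * e - n * h
      · intro e
        linear_combination q * e + i * h
    simp only [decide_eq_true_eq, this]
    split_ifs <;> simp_all
lemma ap_lemma (p j : ℕ) (h2 : 2 ≤ j) (hp : j + 2 ≤ p) (d k : ZMod p)
    (h : ∀ x : ZMod p, (∃ n < j, x = (n : ℕ) * d) ↔ ∃ l < j, x = k + (l : ℕ)) : d = 1 ∨ d = -1 := by
  have : NeZero p := ⟨by omega⟩
  have inj : ∀ x y : ℕ, x < p → y < p → (x : ZMod p) = y → x = y := by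
    intro x y hx hy e
    rwa [ZMod.natCast_eq_natCast_iff', Nat.mod_eq_of_lt hx, Nat.mod_eq_of_lt hy] at e
  have hD : ((d.val : ℕ) : ZMod p) = d := by simp
  have hDp := d.val_lt
  set D := d.val
  by_contra hcon
  push Not at hcon
  have D1 : D ≠ 1 := by rintro e; rw [e] at hD; exact hcon.1 (by simpa using hD.symm)
  have Dm : D ≠ p - 1 := by
    rintro e; rw [e, Nat.cast_sub (by omega)] at hD; exact hcon.2 (by simpa using hD.symm)
  have D0 : D ≠ 0 := by
    rintro e
    have hd : d = 0 := by simpa [e] using hD.symm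
    obtain ⟨n, -, e0⟩ := (h (k + (0 : ℕ))).2 ⟨0, by omega, rfl⟩
    obtain ⟨n', -, e1⟩ := (h (k + (1 : ℕ))).2 ⟨1, by omega, rfl⟩
    rw [hd, mul_zero] at e0 e1
    have := inj 0 1 (by omega) (by omega) (add_left_cancel (e0.trans e1.symm))
    omega
  have out : ∀ x < j, j ≤ (x + D) % p → k + (x : ℕ) = ((j - 1 : ℕ) : ZMod p) * d := by
    intro x hx hxo
    obtain ⟨n, hn, e⟩ := (h (k + (x : ℕ))).2 ⟨x, hx, rfl⟩
    by_cases hnj : n + 1 < j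
    · exfalso
      obtain ⟨l, hl, e'⟩ := (h (((n + 1 : ℕ) : ZMod p) * d)).1 ⟨n + 1, hnj, rfl⟩
      have : ((x + D : ℕ) : ZMod p) = l := by
        push_cast at e' ⊢
        rw [hD]
        linear_combination e + e'
      rw [ZMod.natCast_eq_natCast_iff', Nat.mod_eq_of_lt (show l < p by omega)] at this
      omega
    · rw [e, show n = j - 1 by omega]
  obtain ⟨x, x', hne, hx, hx', o, o'⟩ : ∃ x x', x ≠ x' ∧ x < j ∧ x' < j ∧ j ≤ (x + D) % p ∧ j ≤ (x' + D) % p := by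
    by_cases c1 : D ≤ p - j
    · refine ⟨j - 1, j - 2, by omega, by omega, by omega, ?_, ?_⟩ <;>
        rw [Nat.mod_eq_of_lt (by omega)] <;> omega
    by_cases c2 : j ≤ D
    · refine ⟨0, 1, by omega, by omega, by omega, ?_, ?_⟩ <;>
        rw [Nat.mod_eq_of_lt (by omega)] <;> omega
    · refine ⟨j - D, j - D + 1, by omega, by omega, by omega, ?_, ?_⟩ <;>
        rw [Nat.mod_eq_of_lt (by omega)] <;> omega
  have := (out x hx o).trans (out x' hx' o').symm
  exact hne (inj x x' (by omega) (by omega) (add_left_cancel this))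

open Polynomial in
lemma pspan_ge (f : ℤ[X]) (x y : ℕ) (hx : f.coeff x ≠ 0) (hy : f.coeff y ≠ 0) :
    (y : ℤ) - x ≤ (f.natDegree : ℤ) - f.natTrailingDegree := by
  have h1 := le_natDegree_of_ne_zero hy
  have h2 := natTrailingDegree_le_of_ne_zero hx
  omega

open Polynomial in
lemma pspan_mul (f g : ℤ[X]) (hf : f ≠ 0) (hg : g ≠ 0) :
    ((f * g).natDegree : ℤ) - (f * g).natTrailingDegree =
      ((f.natDegree : ℤ) - f.natTrailingDegree) + ((g.natDegree : ℤ) - g.natTrailingDegree) := by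
  rw [natDegree_mul hf hg, natTrailingDegree_mul hf hg]
  push_cast; ring

open Polynomial in
lemma pspan_sub (u v : ℕ) (h : u ≠ v) :
    (((X ^ u - X ^ v : ℤ[X])).natDegree : ℤ) - (X ^ u - X ^ v : ℤ[X]).natTrailingDegree = |(u : ℤ) - v| := by
  have hc : ∀ i, (X ^ u - X ^ v : ℤ[X]).coeff i ≠ 0 → i = u ∨ i = v := by
    intro i hi
    by_contra hcon
    push Not at hcon
    apply hi
    simp [coeff_X_pow, hcon.1, hcon.2]
  have hu : (X ^ u - X ^ v : ℤ[X]).coeff u ≠ 0 := by simp [coeff_X_pow, h]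
  have hv : (X ^ u - X ^ v : ℤ[X]).coeff v ≠ 0 := by simp [coeff_X_pow, Ne.symm h]
  have hne : (X ^ u - X ^ v : ℤ[X]) ≠ 0 := by
    intro e; rw [e] at hu; simp at hu
  have h1 := le_natDegree_of_ne_zero hu
  have h2 := natTrailingDegree_le_of_ne_zero hu
  have h3 := le_natDegree_of_ne_zero hv
  have h4 := natTrailingDegree_le_of_ne_zero hv
  have h5 := hc _ (show _ ≠ _ from leadingCoeff_ne_zero.2 hne)
  have h6 := hc _ (show _ ≠ _ from mt trailingCoeff_eq_zero.1 hne)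
  rcases abs_cases ((u : ℤ) - v) with ⟨e, _⟩ | ⟨e, _⟩ <;> rw [e] <;> omega

open LaurentPolynomial Polynomial in
lemma span_lemma (E : Finset ℤ) (U : ℤ[T;T⁻¹]) (m b : ℤ) (hb : b ≠ 0)
    (h : (∑ x ∈ E, (T x : ℤ[T;T⁻¹])) * U * (T m - 1) = T b - 1) (x y : ℤ) (hx : x ∈ E) (hy : y ∈ E) :
    y - x < |b| := by
  obtain ⟨N, hNE, hNm, hNb⟩ : ∃ N : ℕ, (∀ x ∈ E, 0 ≤ x + N) ∧ 0 ≤ m + N ∧ 0 ≤ b + N := by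
    refine ⟨∑ x ∈ E, x.natAbs + m.natAbs + b.natAbs, fun x hx => ?_, by omega, by omega⟩
    have := Finset.single_le_sum (f := fun x : ℤ => x.natAbs) (fun _ _ => Nat.zero_le _) hx
    omega
  obtain ⟨n, U0, hU⟩ := exists_T_pow U
  have tX : ∀ x : ℤ, 0 ≤ x + N → toLaurent (X ^ (x + N).toNat : ℤ[X]) = T x * T N := by
    intro x hx
    rw [toLaurent_X_pow, Int.toNat_of_nonneg hx, T_add]
  set S0 : ℤ[X] := ∑ x ∈ E, X ^ (x + N).toNat with hS0
  have hS : toLaurent S0 = (∑ x ∈ E, (T x : ℤ[T;T⁻¹])) * T N := by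
    rw [hS0, map_sum, Finset.sum_mul]
    exact Finset.sum_congr rfl fun x hx => tX x (hNE x hx)
  have hM : toLaurent (X ^ (m + N).toNat - X ^ N : ℤ[X]) = (T m - 1) * T N := by
    rw [map_sub, tX m hNm, toLaurent_X_pow]; ring
  have hB : toLaurent (X ^ (b + N).toNat - X ^ N : ℤ[X]) = (T b - 1) * T N := by
    rw [map_sub, tX b hNb, toLaurent_X_pow]; ring
  have key : S0 * U0 * (X ^ (m + N).toNat - X ^ N) = (X ^ (b + N).toNat - X ^ N) * X ^ (N + n) := by
    apply toLaurent_injective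
    rw [map_mul, map_mul, hS, hM, hU, map_mul, hB, ← h, toLaurent_X_pow]
    push_cast
    rw [T_add]; ring
  have hbN : (b + N).toNat ≠ N := by omega
  have hB0 : (X ^ (b + N).toNat - X ^ N : ℤ[X]) ≠ 0 := by
    intro e
    have := congrArg (fun f => f.coeff N) e
    simp [coeff_X_pow, hbN.symm] at this
  have hne : (X ^ (b + N).toNat - X ^ N : ℤ[X]) * X ^ (N + n) ≠ 0 :=
    mul_ne_zero hB0 (pow_ne_zero _ X_ne_zero)
  have hne' := hne
  rw [← key] at hne'
  have hM0 := right_ne_zero_of_mul hne'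
  have hSU := left_ne_zero_of_mul hne'
  have hU0 := right_ne_zero_of_mul hSU
  have hS00 := left_ne_zero_of_mul hSU
  have hmN : (m + N).toNat ≠ N := by
    intro e; rw [e] at hM0; simp at hM0
  have e1 := pspan_mul _ _ hSU hM0
  rw [pspan_mul _ _ hS00 hU0, key, pspan_mul _ _ hB0 (pow_ne_zero _ X_ne_zero), pspan_sub _ _ hbN,
    pspan_sub _ _ hmN] at e1
  have hSc : ∀ x ∈ E, S0.coeff (x + N).toNat ≠ 0 := by
    intro x hx
    rw [hS0, finsetSum_coeff, Finset.sum_eq_single x]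
    · simp
    · intro y hy hyx
      have := hNE x hx
      have := hNE y hy
      rw [coeff_X_pow, if_neg]; omega
    · simp [hx]
  have e2 := pspan_ge S0 _ _ (hSc x hx) (hSc y hy)
  have e3 := natTrailingDegree_le_natDegree U0
  have e4 : 0 < |(((m + N).toNat : ℕ) : ℤ) - N| := abs_pos.2 (by omega)
  have hxx := hNE x hx
  have hyy := hNE y hy
  simp only [natDegree_X_pow, natTrailingDegree_X_pow, Int.toNat_of_nonneg hNb, Int.toNat_of_nonneg hxx, Int.toNat_of_nonneg hyy, add_sub_cancel_right] at e1 e2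
  omega

open LaurentPolynomial in
/-- Affine action. -/
noncomputable def affEquiv (a : ℤ) (c : ℤ[T;T⁻¹]) : Equiv.Perm ℤ[T;T⁻¹] where
  toFun x := T a * x + c
  invFun x := T (-a) * (x - c)
  left_inv x := by
    simp only [add_sub_cancel_right]
    rw [← mul_assoc, ← T_add]; simp
  right_inv x := by
    simp only
    rw [← mul_assoc, ← T_add]; simp

open LaurentPolynomial in
noncomputable def rho (a b : ℤ) : FreeGroup Bool →* Equiv.Perm ℤ[T;T⁻¹] :=
  FreeGroup.lift fun c => if c then affEquiv a 1 else affEquiv b 0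

open LaurentPolynomial in
lemma mem_gen (ρ : FreeGroup Bool →* Equiv.Perm ℤ[T;T⁻¹]) (w w' : FreeGroup Bool)
    (hc : Subgroup.closure {w, w'} = ⊤) (S T0 : ℤ[T;T⁻¹]) (m : ℤ)
    (hw : ∀ x, ρ w x = x + S) (hw' : ∀ x, ρ w' x = T m * x + T0) (u : FreeGroup Bool) :
    ∃ (n : ℤ) (α c : ℤ[T;T⁻¹]), (T m - 1) * c = T n - 1 ∧ ∀ x, ρ u x = T n * x + (α * S + c * T0) := by
  have hu : u ∈ Subgroup.closure {w, w'} := by rw [hc]; trivial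
  induction hu using Subgroup.closure_induction with
  | mem u hu =>
    rcases hu with rfl | rfl
    · exact ⟨0, 1, 0, by simp, fun x => by simp [hw]⟩
    · exact ⟨m, 0, 1, by simp, fun x => by simp [hw']⟩
  | one => exact ⟨0, 0, 0, by simp, fun x => by simp⟩
  | mul u v _ _ hu hv =>
    obtain ⟨n, α, c, h1, h2⟩ := hu
    obtain ⟨n', α', c', h1', h2'⟩ := hv
    refine ⟨n + n', α + T n * α', c + T n * c', ?_, fun x => ?_⟩
    · rw [T_add]; linear_combination h1 + T n * h1'
    · rw [map_mul, Equiv.Perm.mul_apply, h2', h2, T_add]; ring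
  | inv u _ hu =>
    obtain ⟨n, α, c, h1, h2⟩ := hu
    have hT : (T n * T (-n) : ℤ[T;T⁻¹]) = 1 := by rw [← T_add]; simp
    refine ⟨-n, -T (-n) * α, -T (-n) * c, ?_, fun x => ?_⟩
    · linear_combination -T (-n) * h1 - hT
    · rw [map_inv, Equiv.Perm.inv_eq_iff_eq, h2]
      linear_combination (α * S + c * T0 - x) * hT

open LaurentPolynomial in
lemma rho_affine (a b : ℤ) (u : FreeGroup Bool) :
    ∃ (n : ℤ) (c : ℤ[T;T⁻¹]), ∀ x, rho a b u x = T n * x + c := by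
  have hu : u ∈ Subgroup.closure (Set.range (FreeGroup.of : Bool → _)) := by
    rw [FreeGroup.closure_range_of]; trivial
  induction hu using Subgroup.closure_induction with
  | mem u hu =>
    obtain ⟨c, rfl⟩ := hu
    cases c
    · exact ⟨b, 0, fun x => by simp [rho, affEquiv]⟩
    · exact ⟨a, 1, fun x => by simp [rho, affEquiv]⟩
  | one => exact ⟨0, 0, fun x => by simp⟩
  | mul u v _ _ hu hv =>
    obtain ⟨n, c, h2⟩ := hu
    obtain ⟨n', c', h2'⟩ := hv
    refine ⟨n + n', c + T n * c', fun x => ?_⟩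
    rw [map_mul, Equiv.Perm.mul_apply, h2', h2, T_add]; ring
  | inv u _ hu =>
    obtain ⟨n, c, h2⟩ := hu
    have hT : (T n * T (-n) : ℤ[T;T⁻¹]) = 1 := by rw [← T_add]; simp
    refine ⟨-n, -T (-n) * c, fun x => ?_⟩
    rw [map_inv, Equiv.Perm.inv_eq_iff_eq, h2]
    linear_combination (c - x) * hT

open LaurentPolynomial in
lemma primitive_span (a b : ℤ) (hb : b ≠ 0) (w : FreeGroup Bool) (hp : IsPrimitive w) (E : Finset ℤ)
    (hw : ∀ x, rho a b w x = x + ∑ e ∈ E, T e) (x y : ℤ) (hx : x ∈ E) (hy : y ∈ E) :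
    y - x < |b| := by
  obtain ⟨w', hc⟩ := hp
  obtain ⟨m, T0, hw'⟩ := rho_affine a b w'
  obtain ⟨n, α, c, h1, h2⟩ := mem_gen (rho a b) w w' hc _ T0 m hw hw' (FreeGroup.of true)
  obtain ⟨n', α', c', h1', h2'⟩ := mem_gen (rho a b) w w' hc _ T0 m hw hw' (FreeGroup.of false)
  simp only [rho, FreeGroup.lift_apply_of, affEquiv, Equiv.coe_fn_mk, if_true, Bool.false_eq_true, if_false] at h2 h2'
  have z0 := h2 0
  have y0 := h2' 0
  have y1 := h2' 1
  simp only [mul_zero, zero_add, mul_one, add_zero] at z0 y0 y1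
  rw [← y0, add_zero] at y1
  rw [← y1] at h1'
  refine span_lemma E (c' * α - c * α') m b hb ?_ x y hx hy
  linear_combination h1' + (-(c' * z0) + c * y0) * (T m - 1)

open LaurentPolynomial in
lemma rho_word (a b : ℤ) (f : ℕ → Bool) (k : ℕ) : ∀ x,
    rho a b (wordOf ((List.range k).map f)) x = T (∑ i ∈ Finset.range k, if f i then a else b) * x +
      ∑ i ∈ Finset.range k with f i = true, T (∑ i ∈ Finset.range i, if f i then a else b) := by
  induction k with
  | zero => simp [wordOf]
  | succ k ih =>
    intro x
    have : wordOf ((List.range (k + 1)).map f) = wordOf ((List.range k).map f) * FreeGroup.of (f k) := by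
      simp [wordOf, List.range_succ]
    rw [this, map_mul, Equiv.Perm.mul_apply, ih, Finset.sum_range_succ, Finset.range_add_one, Finset.filter_insert, T_add]
    have h1 : rho a b (FreeGroup.of (f k)) x = T (if f k = true then a else b) * x + if f k = true then 1 else 0 := by
      cases f k <;> simp [rho, affEquiv]
    rw [h1]
    by_cases hf : f k = true
    · rw [if_pos hf, if_pos hf, if_pos hf, Finset.sum_insert (by simp)]
      ring
    · rw [if_neg hf, if_neg hf, if_neg hf]
      ring
lemma chi_word {M : Type*} [AddCommGroup M] (χ : FreeGroup Bool →* Multiplicative M) (f : ℕ → Bool) (k : ℕ) :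
    χ (wordOf ((List.range k).map f)) = Multiplicative.ofAdd
      (∑ i ∈ Finset.range k, (χ (FreeGroup.of (f i))).toAdd) := by
  induction k with
  | zero => simp [wordOf]
  | succ k ih =>
    have : wordOf ((List.range (k + 1)).map f) = wordOf ((List.range k).map f) * FreeGroup.of (f k) := by
      simp [wordOf, List.range_succ]
    rw [this, map_mul, ih, Finset.sum_range_succ, ofAdd_add]
    rfl

lemma coprime_of_primitive (p j : ℕ) (f : ℕ → Bool) (hcard : ((Finset.range p).filter fun i => f i = true).card = j)
    (hp : IsPrimitive (wordOf ((List.range p).map f))) : Nat.Coprime j p := by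
  obtain ⟨w', hc⟩ := hp
  set w := wordOf ((List.range p).map f) with hw
  set g := Nat.gcd j p with hg
  let χ : FreeGroup Bool →* Multiplicative (ZMod g × ZMod g) :=
    FreeGroup.lift fun c => Multiplicative.ofAdd (if c then (1, 0) else (0, 1))
  have hjg : ((j : ℕ) : ZMod g) = 0 := (ZMod.natCast_eq_zero_iff _ _).2 (Nat.gcd_dvd_left _ _)
  have hpg : ((p : ℕ) : ZMod g) = 0 := (ZMod.natCast_eq_zero_iff _ _).2 (Nat.gcd_dvd_right _ _)
  have hχ : χ w = 1 := by
    rw [hw, chi_word]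
    have : ∀ i, (χ (FreeGroup.of (f i))).toAdd = ((if f i = true then 1 else 0 : ZMod g), (1 - if f i = true then 1 else 0 : ZMod g)) := by
      intro i
      cases hf : f i <;> simp [χ]
    simp only [this]
    rw [← ofAdd_zero]
    congr 1
    have hs : (∑ i ∈ Finset.range p, (if f i = true then 1 else 0 : ZMod g)) = 0 := by
      rw [Finset.sum_boole, hcard, hjg]
    ext
    · simpa [Prod.fst_sum] using hs
    · simpa [Prod.snd_sum, hpg] using hs
  have hle : Subgroup.closure {w, w'} ≤ (Subgroup.zpowers (χ w')).comap χ := by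
    rw [Subgroup.closure_le]
    rintro u (rfl | rfl)
    · simp [hχ]
    · simp
  rw [hc] at hle
  obtain ⟨k, hk⟩ := hle (Subgroup.mem_top (FreeGroup.of true))
  obtain ⟨l, hl⟩ := hle (Subgroup.mem_top (FreeGroup.of false))
  have hk' := congrArg Multiplicative.toAdd hk
  have hl' := congrArg Multiplicative.toAdd hl
  simp only [toAdd_zpow] at hk' hl'
  have k1 := congrArg Prod.fst hk'
  have k2 := congrArg Prod.snd hk'
  have l1 := congrArg Prod.fst hl'
  have l2 := congrArg Prod.snd hl'
  simp [χ] at k1 k2 l1 l2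
  have : (1 : ZMod g) = 0 := by
    set c := (Multiplicative.toAdd (χ w')).1
    set d := (Multiplicative.toAdd (χ w')).2
    have k1 : (k : ZMod g) * c = 1 := k1
    have k2 : (k : ZMod g) * d = 0 := k2
    have l1 : (l : ZMod g) * c = 0 := l1
    have l2 : (l : ZMod g) * d = 1 := l2
    linear_combination (-1 : ZMod g) * k1 - k * c * l2 + l * c * k2
  have h1 : ((1 : ℕ) : ZMod g) = 0 := by simpa using this
  rw [ZMod.natCast_eq_zero_iff] at h1
  exact Nat.dvd_one.1 h1

lemma nec_main (p q j : ℕ) (hp2 : 2 ≤ p) (hcop : Nat.Coprime p q) (hj : j ≤ p)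
    (h : IsPrimitive (wordOf (pqLetters p q j))) :
    1 ≤ j ∧ j < p ∧ (j = 1 ∨ j = p - 1 ∨ (q * j : ZMod p) = 1 ∨ (q * j : ZMod p) = -1) := by
  have hNe : NeZero p := ⟨by omega⟩
  obtain ⟨f, hf, hpq⟩ : ∃ f : ℕ → Bool, (∀ i, f i = true ↔ ∃ n < j, (i : ZMod p) = n * q) ∧
      pqLetters p q j = (List.range p).map f := by
    refine ⟨_, fun i => ?_, rfl⟩
    rw [← letter_iff, decide_eq_true_iff]
  rw [hpq] at h
  have inj : ∀ x y : ℕ, x < p → y < p → (x : ZMod p) = y → x = y := by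
    intro x y hx hy e
    rwa [ZMod.natCast_eq_natCast_iff', Nat.mod_eq_of_lt hx, Nat.mod_eq_of_lt hy] at e
  have uq : IsUnit (q : ZMod p) := (ZMod.isUnit_iff_coprime _ _).2 hcop.symm
  have hcard : ((Finset.range p).filter fun i => f i = true).card = j := by
    have : (Finset.range p).filter (fun i => f i = true) = (Finset.range j).image fun n => n * q % p := by
      ext i
      simp only [Finset.mem_filter, Finset.mem_range, hf, Finset.mem_image]
      constructor
      · rintro ⟨hi, n, hn, e⟩
        refine ⟨n, hn, ?_⟩
        rw [← Nat.cast_mul, ZMod.natCast_eq_natCast_iff', Nat.mod_eq_of_lt hi] at e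
        exact e.symm
      · rintro ⟨n, hn, rfl⟩
        exact ⟨Nat.mod_lt _ (by omega), n, hn, by simp⟩
    rw [this, Finset.card_image_of_injOn, Finset.card_range]
    intro x hx y hy e
    simp only [Finset.coe_range, Set.mem_Iio] at hx hy
    rw [← ZMod.natCast_eq_natCast_iff'] at e
    push_cast at e
    exact inj x y (by omega) (by omega) (uq.mul_right_cancel e)
  have hco := coprime_of_primitive p j f hcard h
  have hj1 : 1 ≤ j := by
    rcases Nat.eq_zero_or_pos j with rfl | h
    · simp at hco; omega
    · exact h
  have hjp : j < p := by
    rcases hj.lt_or_eq with h | rfl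
    · exact h
    · simp at hco; omega
  refine ⟨hj1, hjp, ?_⟩
  by_cases c1 : j = 1
  · exact Or.inl c1
  by_cases c2 : j = p - 1
  · exact Or.inr (Or.inl c2)
  right; right
  have uj : IsUnit (j : ZMod p) := (ZMod.isUnit_iff_coprime _ _).2 hco
  set e : ℕ → ℤ := fun k => ∑ i ∈ Finset.range k, if f i = true then ((p : ℤ) - j) else -(j : ℤ) with he
  have emod : ∀ k, ((e k : ℤ) : ZMod p) = -(j * k) := by
    intro k
    have : ∀ i, (((if f i = true then ((p : ℤ) - j) else -(j : ℤ)) : ℤ) : ZMod p) = - j := by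
      intro i; split_ifs <;> simp
    rw [he]
    simp only [Int.cast_sum, this]
    simp [mul_comm]
  have ep : e p = 0 := by
    have : ∀ i, (if f i = true then ((p : ℤ) - j) else -(j : ℤ)) = (if f i = true then 1 else 0) * p - j := by
      intro i; split_ifs <;> ring
    rw [he]
    simp only [this]
    rw [Finset.sum_sub_distrib, ← Finset.sum_mul, Finset.sum_boole, hcard]
    simp [mul_comm]
  set I := (Finset.range p).filter fun i => f i = true with hI
  have einj : Set.InjOn e I := by
    intro x hx y hy exy
    simp only [hI, Finset.coe_filter, Finset.mem_range, Set.mem_ofPred_eq] at hx hy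
    have h1 := emod x
    rw [exy, emod y, neg_inj] at h1
    exact (inj y x hy.1 hx.1 (uj.mul_left_cancel h1)).symm
  set E := I.image e with hE
  have hEcard : E.card = j := by rw [hE, Finset.card_image_of_injOn einj, hcard]
  have hspan := primitive_span ((p : ℤ) - j) (-(j : ℤ)) (by omega) _ h E (by
    intro x
    rw [rho_word, hE, Finset.sum_image einj]
    have := ep
    rw [he] at this
    simp only at this
    rw [this]
    simp [hI, he])
  rw [abs_neg, Nat.abs_cast] at hspan
  have hEne : E.Nonempty := Finset.card_pos.1 (by omega)
  set k := E.min' hEne with hk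
  have hEk : E = Finset.Ico k (k + j) := by
    apply Finset.eq_of_subset_of_card_le
    · intro y hy
      have h1 := hspan k y (Finset.min'_mem _ _) hy
      have h2 := Finset.min'_le E y hy
      rw [Finset.mem_Ico]
      exact ⟨h2, by omega⟩
    · simp [hEcard]
  have := ap_lemma p j (by omega) (by omega) (-(j * q)) (k : ZMod p) (by
    intro x
    constructor
    · rintro ⟨n, hn, rfl⟩
      have hmem : e (n * q % p) ∈ E := by
        rw [hE]
        apply Finset.mem_image_of_mem
        rw [hI, Finset.mem_filter, Finset.mem_range, hf]
        exact ⟨Nat.mod_lt _ (by omega), n, hn, by simp⟩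
      have hmod := emod (n * q % p)
      rw [hEk, Finset.mem_Ico] at hmem
      refine ⟨(e (n * q % p) - k).toNat, by omega, ?_⟩
      have h3 : (((e (n * q % p) - k).toNat : ℕ) : ZMod p) = ((e (n * q % p) - k : ℤ) : ZMod p) := by
        rw [← Int.cast_natCast, Int.toNat_of_nonneg (by omega)]
      rw [h3, Int.cast_sub, hmod]
      simp
      ring
    · rintro ⟨l, hl, rfl⟩
      have hmem : k + l ∈ E := by rw [hEk, Finset.mem_Ico]; omega
      rw [hE, Finset.mem_image] at hmem
      obtain ⟨i, hi, hil⟩ := hmem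
      rw [hI, Finset.mem_filter, hf] at hi
      obtain ⟨_, n, hn, hin⟩ := hi
      refine ⟨n, hn, ?_⟩
      have hmod := emod i
      rw [hil] at hmod
      push_cast at hmod
      rw [hmod, hin]
      ring)
  rcases this with h | h
  · right; linear_combination -h
  · left; linear_combination -h

lemma prim_one (p q : ℕ) (hp : 2 ≤ p) : IsPrimitive (wordOf (pqLetters p q 1)) := by
  obtain ⟨r, rfl⟩ := Nat.exists_eq_add_of_le' (show 1 ≤ p by omega)
  have : wordOf (pqLetters (r + 1) q 1) = FreeGroup.of true * FreeGroup.of false ^ r := by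
    have h0 : pqLetters (r + 1) q 1 = true :: List.replicate r false := by
      unfold pqLetters
      rw [List.range_succ_eq_map, List.map_cons, List.map_map]
      congr 1
      · simp
      · rw [List.eq_replicate_iff]
        refine ⟨by simp, ?_⟩
        intro b hb
        rw [List.mem_map] at hb
        obtain ⟨i, hi, rfl⟩ := hb
        rw [List.mem_range] at hi
        simp only [Function.comp, letter_iff]
        rw [decide_eq_false_iff_not]
        rintro ⟨n, hn, e⟩
        obtain rfl : n = 0 := by omega
        rw [Nat.cast_zero, zero_mul, ZMod.natCast_eq_zero_iff] at e
        have := Nat.le_of_dvd (by omega) e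
        omega
    rw [h0]
    simp [wordOf]
  rw [this]
  refine ⟨FreeGroup.of false, ?_⟩
  rw [eq_top_iff, ← FreeGroup.closure_range_of, Subgroup.closure_le]
  set H := Subgroup.closure {FreeGroup.of true * FreeGroup.of false ^ r, FreeGroup.of false}
  have h1 : FreeGroup.of true * FreeGroup.of false ^ r ∈ H := Subgroup.subset_closure (by simp)
  have h2 : FreeGroup.of false ∈ H := Subgroup.subset_closure (by simp)
  rintro _ ⟨c, rfl⟩
  cases c
  · exact h2
  · simpa using mul_mem h1 (inv_mem (pow_mem h2 r))

lemma prim_last (p q : ℕ) (hp : 2 ≤ p) (hcop : Nat.Coprime p q) :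
    IsPrimitive (wordOf (pqLetters p q (p - 1))) := by
  have hNe : NeZero p := ⟨by omega⟩
  obtain ⟨u, hu⟩ : IsUnit (q : ZMod p) := (ZMod.isUnit_iff_coprime _ _).2 hcop.symm
  set s := ((p - 1) * q) % p with hs
  have hsp : s < p := Nat.mod_lt _ (by omega)
  have letter : ∀ i < p, (∃ n < p - 1, (i : ZMod p) = n * q) ↔ i ≠ s := by
    intro i hi
    constructor
    · rintro ⟨n, hn, e⟩ rfl
      rw [hs, ZMod.natCast_mod, Nat.cast_mul, ← hu] at e
      have e := u.isUnit.mul_right_cancel e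
      rw [ZMod.natCast_eq_natCast_iff', Nat.mod_eq_of_lt (by omega), Nat.mod_eq_of_lt (by omega)] at e
      omega
    · intro hne
      set n := ((i : ZMod p) * ↑u⁻¹).val with hn
      have hnp : n < p := ZMod.val_lt _
      have e : (i : ZMod p) = n * q := by
        rw [hn, ZMod.natCast_val, ZMod.cast_id, ← hu, mul_assoc, Units.inv_mul, mul_one]
      refine ⟨n, ?_, e⟩
      by_contra hcon
      apply hne
      rw [show n = p - 1 by omega, ← Nat.cast_mul, ZMod.natCast_eq_natCast_iff', Nat.mod_eq_of_lt hi] at e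
      exact e
  obtain ⟨r, hr⟩ := Nat.exists_eq_add_of_lt hsp
  have h0 : pqLetters p q (p - 1) = List.replicate s true ++ false :: List.replicate r true := by
    apply List.ext_getElem
    · simp [pqLetters]; omega
    · intro i h1 h2
      have hi : i < p := by simpa [pqLetters] using h1
      simp only [pqLetters, List.getElem_map, List.getElem_range, letter_iff, letter i hi]
      rcases lt_trichotomy i s with h | h | h
      · rw [List.getElem_append_left (by simpa using h)]
        simp; omega
      · rw [List.getElem_append_right (by simp; omega)]
        simp [h]
      · rw [List.getElem_append_right (by simp; omega)]
        obtain ⟨t, ht⟩ := Nat.exists_eq_add_of_lt h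
        simp [ht, show s + t + 1 - s = t + 1 by omega]
        omega
  have : wordOf (pqLetters p q (p - 1)) = FreeGroup.of true ^ s * (FreeGroup.of false * FreeGroup.of true ^ r) := by
    rw [h0]; simp [wordOf]
  rw [this]
  refine ⟨FreeGroup.of true, ?_⟩
  rw [eq_top_iff, ← FreeGroup.closure_range_of, Subgroup.closure_le]
  set H := Subgroup.closure {FreeGroup.of true ^ s * (FreeGroup.of false * FreeGroup.of true ^ r), FreeGroup.of true}
  have h1 : FreeGroup.of true ^ s * (FreeGroup.of false * FreeGroup.of true ^ r) ∈ H := Subgroup.subset_closure (by simp)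
  have h2 : FreeGroup.of true ∈ H := Subgroup.subset_closure (by simp)
  rintro _ ⟨c, rfl⟩
  cases c
  · have := mul_mem (mul_mem (inv_mem (pow_mem h2 s)) h1) (inv_mem (pow_mem h2 r))
    simpa [mul_assoc] using this
  · exact h2

/-- For coprime `p > q ≥ 1`, with `q'` the unique integer satisfying
`1 ≤ q' ≤ p/2` and `q·q' ≡ ±1 (mod p)`, the word `w_j` of the `(p,q)`-sequence
is primitive if and only if `j ∈ {1, q', p−q', p−1}`. -/
theorem pqSequence_primitive_iff (p q q' : ℕ) (hq : 1 ≤ q) (hqp : q < p)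
    (hcop : Nat.Coprime p q) (hq'1 : 1 ≤ q') (hq'2 : 2 * q' ≤ p)
    (hqq' : ((q * q' : ℕ) : ℤ) ≡ 1 [ZMOD (p : ℤ)] ∨
            ((q * q' : ℕ) : ℤ) ≡ -1 [ZMOD (p : ℤ)])
    (j : ℕ) (hj : j ≤ p) :
    IsPrimitive (wordOf (pqLetters p q j)) ↔
      j = 1 ∨ j = q' ∨ j = p - q' ∨ j = p - 1 := by
  have hq'c : (q * q' : ZMod p) = 1 ∨ (q * q' : ZMod p) = -1 := by
    rcases hqq' with h | h
    · left
      have := (ZMod.intCast_eq_intCast_iff _ _ p).2 h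
      push_cast at this
      exact this
    · right
      have := (ZMod.intCast_eq_intCast_iff _ _ p).2 h
      push_cast at this
      exact this
  have hsub : ((p - q' : ℕ) : ZMod p) = - q' := by
    rw [Nat.cast_sub (by omega)]; simp
  constructor
  · intro h
    obtain ⟨h1, h2, h3⟩ := nec_main p q j (by omega) hcop hj h
    have uq : IsUnit (q : ZMod p) := (ZMod.isUnit_iff_coprime _ _).2 hcop.symm
    have inj : ∀ x y : ℕ, x < p → y < p → (x : ZMod p) = y → x = y := by
      intro x y hx hy e
      rwa [ZMod.natCast_eq_natCast_iff', Nat.mod_eq_of_lt hx, Nat.mod_eq_of_lt hy] at e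
    have fin : (q * j : ZMod p) = q * q' ∨ (q * j : ZMod p) = q * ((p - q' : ℕ) : ZMod p) →
        j = 1 ∨ j = q' ∨ j = p - q' ∨ j = p - 1 := by
      rintro (e | e)
      · exact Or.inr (Or.inl (inj _ _ (by omega) (by omega) (uq.mul_left_cancel e)))
      · exact Or.inr (Or.inr (Or.inl (inj _ _ (by omega) (by omega) (uq.mul_left_cancel e))))
    rcases h3 with h3 | h3 | h3
    · exact Or.inl h3
    · exact Or.inr (Or.inr (Or.inr h3))
    · apply fin
      rw [hsub]
      rcases h3 with h3 | h3 <;> rcases hq'c with h4 | h4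
      · left; rw [h3, h4]
      · right; linear_combination h3 + h4
      · right; linear_combination h3 + h4
      · left; rw [h3, h4]
  · rintro (rfl | rfl | rfl | rfl)
    · exact prim_one p q (by omega)
    · exact suff_main p q _ hq'1 (by omega) hq'c
    · refine suff_main p q _ (by omega) (by omega) ?_
      rw [hsub]
      rcases hq'c with h | h
      · right; linear_combination -h
      · left; linear_combination -h
    · exact prim_last p q (by omega) hcop
end

section
/- Let F = ⟨x,y⟩ be the free group of rank 2 and let w be an element admitting a cyclically reduced form that contains both a subword x·y^n·x and a subword y^{n+2} for some integer n ≥ 0, with all occurrences of x and y in this form having positive exponent sign. Then w is not a positive power of any primitive element of F. -/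
theorem laurent_coeff_T_mul (n i : ℤ) (f : LaurentPolynomial ℤ) :
    (LaurentPolynomial.T n * f).coeff i = f.coeff (i - n) := by
  have := AddMonoidAlgebra.coeff_single_mul_apply f (1 : ℤ) n i
  rw [one_mul] at this
  rw [sub_eq_add_neg, add_comm]
  exact this

open LaurentPolynomial in
/-- A nonnegative Laurent polynomial dividing `k (T^N - 1)` has width less than `N`. -/
theorem width_lt (a m : LaurentPolynomial ℤ) (k : ℤ) (hk : k ≠ 0) (N : ℕ) (hN : 0 < N)
    (h : a * m = C k * (T (N : ℤ) - 1)) (hpos : ∀ i, 0 ≤ a.coeff i) (i j : ℤ)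
    (hi : a.coeff i ≠ 0) (hj : a.coeff j ≠ 0) : j - i < N := by
  obtain ⟨r, A, hA⟩ := a.exists_T_pow
  obtain ⟨s, M, hM⟩ := m.exists_T_pow
  have key : A * M = Polynomial.C k * (Polynomial.X ^ N - 1) * Polynomial.X ^ (r + s) := by
    apply Polynomial.toLaurent_injective
    simp only [map_mul, map_sub, map_one, Polynomial.toLaurent_C, Polynomial.toLaurent_X_pow, hA, hM]
    rw [mul_mul_mul_comm, h, ← T_add]
    push_cast
    rfl
  have hcoef : ∀ n : ℕ, A.coeff n = a.coeff ((n : ℤ) - r) := by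
    intro n
    have h1 : (Polynomial.toLaurent A).coeff (n : ℤ) = (a * T (r : ℤ)).coeff (n : ℤ) := by rw [hA]
    have h2 : (Polynomial.toLaurent A).coeff (n : ℤ) = A.coeff n := by
      rw [LaurentPolynomial.coeff_toLaurent]
      exact Finsupp.mapDomain_apply Nat.castEmbedding.injective _ n
    have h3 : (a * T (r : ℤ)).coeff (n : ℤ) = a.coeff ((n : ℤ) - r) := by
      rw [mul_comm, laurent_coeff_T_mul]
    rw [← h2, h1, h3]
  have hcoef' : ∀ l : ℤ, a.coeff l ≠ 0 → ∃ n : ℕ, (n : ℤ) = l + r ∧ A.coeff n ≠ 0 := by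
    intro l hl
    have h3 : (a * T (r : ℤ)).coeff (l + r) = a.coeff l := by
      rw [mul_comm, laurent_coeff_T_mul, add_sub_cancel_right]
    rw [← hA] at h3
    by_cases hneg : 0 ≤ l + r
    · obtain ⟨n, hn⟩ := Int.eq_ofNat_of_zero_le hneg
      refine ⟨n, hn.symm, ?_⟩
      rw [hcoef n, ← hn]
      simpa using hl
    · exfalso
      apply hl
      rw [← h3, LaurentPolynomial.coeff_toLaurent]
      apply Finsupp.mapDomain_notin_range
      rintro ⟨n, hn⟩
      apply hneg
      rw [← hn]
      simp
  obtain ⟨i', hi', hAi⟩ := hcoef' i hi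
  obtain ⟨j', hj', hAj⟩ := hcoef' j hj
  have hA0 : A ≠ 0 := by rintro rfl; simp at hAi
  have hq : (Polynomial.X ^ N - 1 : Polynomial ℤ) ≠ 0 := by
    exact Polynomial.X_pow_sub_C_ne_zero hN 1
  have hR0 : Polynomial.C k * (Polynomial.X ^ N - 1) * Polynomial.X ^ (r + s) ≠ 0 := by
    simp [hk, hq]
  have hM0 : M ≠ 0 := by rintro rfl; rw [mul_zero] at key; exact hR0 key.symm
  have hAe : A.eval 1 ≠ 0 := by
    rw [Polynomial.eval_eq_sum_range]
    apply ne_of_gt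
    simp only [one_pow, mul_one]
    apply Finset.sum_pos'
    · intro n _; rw [hcoef]; exact hpos _
    · refine ⟨i', ?_, ?_⟩
      · simp; have := Polynomial.le_natDegree_of_ne_zero hAi; omega
      · apply lt_of_le_of_ne _ hAi.symm
        rw [hcoef]; exact hpos _
  have hMe : M.eval 1 = 0 := by
    have := congrArg (Polynomial.eval 1) key
    simp at this
    tauto
  have hd := congrArg Polynomial.natDegree key
  have ht := congrArg Polynomial.natTrailingDegree key
  have e1 : (Polynomial.C k * (Polynomial.X ^ N - 1) * Polynomial.X ^ (r + s)).natDegree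
      = N + (r + s) := by
    rw [Polynomial.natDegree_mul (by simp [hk, hq]) (by simp), Polynomial.natDegree_C_mul hk,
      Polynomial.natDegree_X_pow, ← Polynomial.C_1, Polynomial.natDegree_X_pow_sub_C]
  have e2 : (Polynomial.C k * (Polynomial.X ^ N - 1) * Polynomial.X ^ (r + s)).natTrailingDegree
      = (r + s) := by
    rw [Polynomial.natTrailingDegree_mul_X_pow (by simp [hk, hq])]
    rw [Polynomial.natTrailingDegree_eq_zero.mpr, zero_add]
    right
    simp [Polynomial.coeff_X_pow, hN.ne, hk]
  rw [e1, Polynomial.natDegree_mul hA0 hM0] at hd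
  rw [e2, Polynomial.natTrailingDegree_mul hA0 hM0] at ht
  have hMw : M.natTrailingDegree < M.natDegree := by
    by_contra hcon
    have hle := Polynomial.natTrailingDegree_le_natDegree M
    apply hM0
    have : M.eval 1 = M.leadingCoeff := by
      rw [Polynomial.eval_eq_sum_range]
      simp only [one_pow, mul_one]
      rw [Finset.sum_range_succ, Finset.sum_eq_zero, zero_add]
      · rfl
      · intro x hx
        apply Polynomial.coeff_eq_zero_of_lt_natTrailingDegree
        simp at hx; omega
    rw [hMe] at this
    exact Polynomial.leadingCoeff_eq_zero.mp this.symm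
  have b1 := Polynomial.le_natDegree_of_ne_zero hAj
  have b2 := Polynomial.natTrailingDegree_le_of_ne_zero hAi
  omega

namespace FoxAux
open LaurentPolynomial

/-- Height homomorphism. -/
noncomputable def ht (s : Bool → ℤ) : FreeGroup Bool →* Multiplicative ℤ :=
  FreeGroup.lift (fun b => Multiplicative.ofAdd (s b))

noncomputable def hh (s : Bool → ℤ) (g : FreeGroup Bool) : ℤ := Multiplicative.toAdd (ht s g)

theorem hh_mul (s : Bool → ℤ) (g g' : FreeGroup Bool) : hh s (g * g') = hh s g + hh s g' := by
  simp [hh]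

theorem hh_inv (s : Bool → ℤ) (g : FreeGroup Bool) : hh s g⁻¹ = - hh s g := by
  simp [hh]

theorem hh_one (s : Bool → ℤ) : hh s 1 = 0 := by
  simp [hh]

theorem hh_of (s : Bool → ℤ) (b : Bool) : hh s (FreeGroup.of b) = s b := by
  simp [hh, ht]

/-- The affine permutation `r ↦ T^n r + d`. -/
noncomputable def aff (n : ℤ) (d : LaurentPolynomial ℤ) : Equiv.Perm (LaurentPolynomial ℤ) where
  toFun r := T n * r + d
  invFun r := T (-n) * (r - d)
  left_inv r := by
    simp only [add_sub_cancel_right, ← mul_assoc, ← T_add]; simp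
  right_inv r := by
    simp only [← mul_assoc, ← T_add]; simp

noncomputable def act (s : Bool → ℤ) (c : Bool) :
    FreeGroup Bool →* Equiv.Perm (LaurentPolynomial ℤ) :=
  FreeGroup.lift (fun b => aff (s b) (if b = c then 1 else 0))

/-- Fox derivative pushed to the Laurent polynomial ring. -/
noncomputable def D (s : Bool → ℤ) (c : Bool) (g : FreeGroup Bool) : LaurentPolynomial ℤ :=
  act s c g 0

theorem act_apply (s : Bool → ℤ) (c : Bool) (g : FreeGroup Bool) :
    ∀ r, act s c g r = T (hh s g) * r + D s c g := by
  induction g using FreeGroup.induction_on with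
  | C1 => intro r; simp [hh_one, D]
  | of b => intro r; simp [hh_of, D, act, aff]
  | inv_of b _ => intro r; simp [hh_of, hh_inv, D, act, aff, Equiv.Perm.inv_def]; split_ifs <;> ring
  | mul x y hx hy =>
    intro r
    have e : D s c (x * y) = T (hh s x) * D s c y + D s c x := by
      conv_lhs => rw [D, map_mul, Equiv.Perm.mul_apply, hx, ← D]
    rw [map_mul, Equiv.Perm.mul_apply, hy, hx, e, hh_mul, T_add]
    ring

theorem D_mul (s : Bool → ℤ) (c : Bool) (x y : FreeGroup Bool) :
    D s c (x * y) = D s c x + T (hh s x) * D s c y := by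
  conv_lhs => rw [D, map_mul, Equiv.Perm.mul_apply, act_apply, ← D]
  ring

theorem D_one (s : Bool → ℤ) (c : Bool) : D s c 1 = 0 := by simp [D]

theorem D_inv (s : Bool → ℤ) (c : Bool) (x : FreeGroup Bool) :
    D s c x⁻¹ = - (T (- hh s x) * D s c x) := by
  have := D_mul s c x⁻¹ x
  rw [inv_mul_cancel, D_one, hh_inv] at this
  linear_combination -this

theorem D_of (s : Bool → ℤ) (c b : Bool) :
    D s c (FreeGroup.of b) = if b = c then 1 else 0 := by
  simp [D, act, aff]

theorem D_pow (s : Bool → ℤ) (c : Bool) (g : FreeGroup Bool) (hg : hh s g = 0) (k : ℕ) :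
    D s c (g ^ k) = (k : LaurentPolynomial ℤ) * D s c g := by
  induction k with
  | zero => simp [D_one]
  | succ k ih =>
    rw [pow_succ', D_mul, ih, hg]
    simp; ring

/-- Fundamental formula. -/
theorem fund (s : Bool → ℤ) (g : FreeGroup Bool) :
    D s true g * (T (s true) - 1) + D s false g * (T (s false) - 1) = T (hh s g) - 1 := by
  induction g using FreeGroup.induction_on with
  | C1 => simp [hh_one, D_one]
  | of b => cases b <;> simp [hh_of, D_of]
  | inv_of b hb =>
    rw [D_inv, D_inv, hh_inv]
    have : T (-hh s (FreeGroup.of b)) * T (hh s (FreeGroup.of b)) = (1 : LaurentPolynomial ℤ) := by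
      rw [← T_add]; simp
    linear_combination (-T (-hh s (FreeGroup.of b))) * hb - this
  | mul x y hx hy =>
    rw [D_mul, D_mul, hh_mul, T_add]
    linear_combination hx + T (hh s x) * hy

theorem chain (s : Bool → ℤ) (g g' f : FreeGroup Bool) (hf : f ∈ Subgroup.closure {g, g'}) :
    ∃ A B : LaurentPolynomial ℤ, ∀ c, D s c f = A * D s c g + B * D s c g' := by
  induction hf using Subgroup.closure_induction with
  | mem x hx =>
    rcases hx with rfl | hx
    · exact ⟨1, 0, by simp⟩
    · rw [Set.mem_singleton_iff] at hx; subst hx; exact ⟨0, 1, by simp⟩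
  | one => exact ⟨0, 0, by simp [D_one]⟩
  | mul x y _ _ hx hy =>
    obtain ⟨A, B, h1⟩ := hx
    obtain ⟨A', B', h2⟩ := hy
    refine ⟨A + T (hh s x) * A', B + T (hh s x) * B', fun c => ?_⟩
    rw [D_mul, h1, h2]; ring
  | inv x _ hx =>
    obtain ⟨A, B, h1⟩ := hx
    refine ⟨-(T (-hh s x) * A), -(T (-hh s x) * B), fun c => ?_⟩
    rw [D_inv, h1]; ring

theorem unimod (s : Bool → ℤ) (g : FreeGroup Bool) (hg : IsPrimitive g) :
    ∃ A B : LaurentPolynomial ℤ, A * D s true g + B * D s false g = 1 := by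
  obtain ⟨g', h⟩ := hg
  obtain ⟨A, B, h1⟩ := chain s g g' (FreeGroup.of true) (by rw [h]; trivial)
  obtain ⟨A', B', h2⟩ := chain s g g' (FreeGroup.of false) (by rw [h]; trivial)
  have a1 := h1 true
  have a2 := h1 false
  have a3 := h2 true
  have a4 := h2 false
  simp only [D_of] at a1 a2 a3 a4
  simp at a1 a2 a3 a4
  refine ⟨(A * B' - B * A') * D s false g', -(A * B' - B * A') * D s true g', ?_⟩
  have e1 : (A * B' - B * A') * (D s true g * D s false g' - D s false g * D s true g')
    = (A * D s true g + B * D s true g') * (A' * D s false g + B' * D s false g')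
     - (A * D s false g + B * D s false g') * (A' * D s true g + B' * D s true g') := by ring
  rw [← a1, ← a2, ← a3, ← a4] at e1
  linear_combination e1

theorem mk_cons (b : Bool) (L : List (Bool × Bool)) :
    FreeGroup.mk ((b, true) :: L) = FreeGroup.of b * FreeGroup.mk L := by
  simp [FreeGroup.of]

theorem mk_app (L L' : List (Bool × Bool)) :
    FreeGroup.mk (L ++ L') = FreeGroup.mk L * FreeGroup.mk L' := by
  simp

theorem coeff_T_mul (n i : ℤ) (f : LaurentPolynomial ℤ) :
    (T n * f).coeff i = f.coeff (i - n) := laurent_coeff_T_mul n i f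

theorem D_nonneg (s : Bool → ℤ) (c : Bool) (L : List (Bool × Bool))
    (hL : ∀ a ∈ L, a.2 = true) : ∀ i, 0 ≤ (D s c (FreeGroup.mk L)).coeff i := by
  induction L with
  | nil => intro i; rw [← FreeGroup.one_eq_mk, D_one]; simp
  | cons a L ih =>
    obtain ⟨b, e⟩ := a
    have : e = true := hL (b, e) (by simp)
    subst this
    intro i
    rw [mk_cons, D_mul, D_of]
    have := ih (fun a ha => hL a (by simp [ha])) (i - hh s (FreeGroup.of b))
    have h1 : 0 ≤ (if b = c then (1 : LaurentPolynomial ℤ) else 0).coeff i := by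
      split_ifs
      · rw [← T_zero, T_apply]; split_ifs <;> simp
      · simp
    have h2 := coeff_T_mul (hh s (FreeGroup.of b)) i (D s c (FreeGroup.mk L))
    rw [AddMonoidAlgebra.coeff_add, Finsupp.add_apply, h2]
    exact add_nonneg h1 this

theorem D_pos (s : Bool → ℤ) (c : Bool) (u v : List (Bool × Bool))
    (hu : ∀ a ∈ u, a.2 = true) (hv : ∀ a ∈ v, a.2 = true) :
    (D s c (FreeGroup.mk (u ++ (c, true) :: v))).coeff (hh s (FreeGroup.mk u)) ≠ 0 := by
  rw [mk_app, mk_cons, D_mul, D_mul, D_of]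
  have h1 := D_nonneg s c u hu (hh s (FreeGroup.mk u))
  have h2 := D_nonneg s c v hv (0 - hh s (FreeGroup.of c))
  rw [AddMonoidAlgebra.coeff_add, Finsupp.add_apply, coeff_T_mul, AddMonoidAlgebra.coeff_add,
    Finsupp.add_apply, coeff_T_mul, sub_self, if_pos rfl, ← T_zero, T_apply, if_pos rfl]
  omega

theorem hh_list (s : Bool → ℤ) (L : List (Bool × Bool)) (hL : ∀ a ∈ L, a.2 = true) :
    hh s (FreeGroup.mk L) = L.count (true, true) * s true + L.count (false, true) * s false := by
  induction L with
  | nil => rw [← FreeGroup.one_eq_mk, hh_one]; simp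
  | cons a L ih =>
    obtain ⟨b, e⟩ := a
    have : e = true := hL (b, e) (by simp)
    subst this
    rw [mk_cons, hh_mul, hh_of, ih (fun a ha => hL a (by simp [ha]))]
    cases b <;> simp [List.count_cons] <;> ring

end FoxAux

open FoxAux LaurentPolynomial in
/-- Let `w ∈ F = ⟨x, y⟩` admit a cyclically reduced form (i.e. a positive word
whose class is conjugate to `w`) containing both a subword `x·y^n·x` and a
subword `y^{n+2}` for some `n ≥ 0`, all letters occurring with positive sign.
Then `w` is not a positive power of any primitive element of `F`.
Letters are pairs `(g, s)` with `g : Bool` the generator (`true` = `x`,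
`false` = `y`) and `s : Bool` the sign (`true` = `+1`). -/
theorem not_power_of_primitive_of_subwords (w : FreeGroup Bool) (n : ℕ)
    (h : ∃ L : List (Bool × Bool),
      (∀ a ∈ L, a.2 = true) ∧
      (∃ u : FreeGroup Bool, u * FreeGroup.mk L * u⁻¹ = w) ∧
      ([(true, true)] ++ List.replicate n (false, true) ++ [(true, true)]) <:+: L ∧
      (List.replicate (n + 2) (false, true)) <:+: L) :
    ¬ ∃ (g : FreeGroup Bool) (k : ℕ), 1 ≤ k ∧ IsPrimitive g ∧ w = g ^ k := by
  rintro ⟨g, k, hk, hg, hw⟩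
  obtain ⟨L, hL, ⟨u, hu⟩, ⟨p1, q1, h1⟩, ⟨p2, q2, h2⟩⟩ := h
  set P := L.count (true, true) with hP
  set Q := L.count (false, true) with hQ
  have hP0 : 0 < P := by
    rw [hP, List.count_pos_iff, ← h1]; simp
  have hQ0 : 0 < Q := by
    rw [hQ, List.count_pos_iff, ← h2]; simp
  let s : Bool → ℤ := fun b => if b then (Q : ℤ) else -(P : ℤ)
  have st : s true = Q := rfl
  have sf : s false = -(P : ℤ) := rfl
  have hhL : hh s (FreeGroup.mk L) = 0 := by
    rw [hh_list s L hL, st, sf, ← hP, ← hQ]; ring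
  have hhp : ∀ j : ℕ, hh s (g ^ j) = j * hh s g := by
    intro j
    induction j with
    | zero => simp [hh_one]
    | succ j ih => rw [pow_succ, hh_mul, ih]; push_cast; ring
  have hhg : hh s g = 0 := by
    have e := hhp k
    rw [← hw, ← hu, hh_mul, hh_mul, hh_inv, hhL] at e
    have e' : (k : ℤ) * hh s g = 0 := by linarith
    rcases mul_eq_zero.mp e' with h | h
    · omega
    · exact h
  have hDL : ∀ c, D s c (FreeGroup.mk L) * T (hh s u) = (k : LaurentPolynomial ℤ) * D s c g := by
    intro c
    have e := D_pow s c g hhg k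
    rw [← hw, ← hu, D_mul, D_mul, D_inv, hh_mul, hhL, add_zero] at e
    have : T (hh s u) * T (-hh s u) = (1 : LaurentPolynomial ℤ) := by
      rw [← T_add]; simp
    linear_combination e + D s c u * this
  obtain ⟨A, B, hAB⟩ := unimod s g hg
  have hf := fund s (FreeGroup.mk L)
  rw [hhL, st, sf, T_zero, sub_self] at hf
  have hTP : T (P : ℤ) * T (-(P : ℤ)) = (1 : LaurentPolynomial ℤ) := by
    rw [← T_add]; simp
  have hk0 : (k : ℤ) ≠ 0 := by omega
  have hCk : (C (k : ℤ) : LaurentPolynomial ℤ) = (k : LaurentPolynomial ℤ) := by simp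
  have uni : A * T (hh s u) * D s true (FreeGroup.mk L)
      + B * T (hh s u) * D s false (FreeGroup.mk L) = (k : LaurentPolynomial ℤ) := by
    linear_combination A * hDL true + B * hDL false + (k : LaurentPolynomial ℤ) * hAB
  have wx := width_lt (D s true (FreeGroup.mk L))
    (T (hh s u) * (A * (T (P : ℤ) - 1) + B * T (P : ℤ) * (T (Q : ℤ) - 1))) k hk0 P hP0
    (by
      rw [hCk]
      linear_combination (T (P : ℤ) - 1) * uni + T (hh s u) * B * T (P : ℤ) * hf
        - T (hh s u) * B * D s false (FreeGroup.mk L) * hTP)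
    (D_nonneg s true L hL)
  have wy := width_lt (D s false (FreeGroup.mk L))
    (T (hh s u) * (B * (T (Q : ℤ) - 1) - A * (T (-(P : ℤ)) - 1))) k hk0 Q hQ0
    (by
      rw [hCk]
      linear_combination (T (Q : ℤ) - 1) * uni - T (hh s u) * A * hf)
    (D_nonneg s false L hL)
  have posx : ∀ u v, L = u ++ (true, true) :: v →
      (D s true (FreeGroup.mk L)).coeff (hh s (FreeGroup.mk u)) ≠ 0 := by
    intro u v e
    rw [e]
    exact D_pos s true u v (fun a ha => hL a (by simp [e, ha])) (fun a ha => hL a (by simp [e, ha]))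
  have posy : ∀ u v, L = u ++ (false, true) :: v →
      (D s false (FreeGroup.mk L)).coeff (hh s (FreeGroup.mk u)) ≠ 0 := by
    intro u v e
    rw [e]
    exact D_pos s false u v (fun a ha => hL a (by simp [e, ha])) (fun a ha => hL a (by simp [e, ha]))
  have hrep : ∀ j : ℕ, hh s (FreeGroup.mk (List.replicate j (false, true))) = -(j * P : ℤ) := by
    intro j
    induction j with
    | zero => rw [List.replicate_zero, ← FreeGroup.one_eq_mk, hh_one]; simp
    | succ j ih => rw [List.replicate_succ, mk_cons, hh_mul, hh_of, ih, sf]; push_cast; ring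
  have x1 := posx p1 (List.replicate n (false, true) ++ [(true, true)] ++ q1) (by rw [← h1]; simp)
  have x2 := posx (p1 ++ (true, true) :: List.replicate n (false, true)) q1 (by rw [← h1]; simp)
  have y1 := posy p2 (List.replicate (n + 1) (false, true) ++ q2) (by
    rw [← h2, List.replicate_succ]; simp)
  have y2 := posy (p2 ++ List.replicate (n + 1) (false, true)) q2 (by
    rw [← h2, List.replicate_succ' (n := n + 1)]; simp)
  have c1 := wx _ _ x1 x2
  have c2 := wy _ _ y2 y1
  rw [mk_app, mk_cons, hh_mul, hh_mul, hh_of, hrep, st] at c1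
  rw [mk_app, hh_mul, hrep] at c2
  push_cast at c2
  nlinarith
end
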